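/- arXiv:1704.01735 — 2 statements merged into one kernel-verified Lean document; each statement's English description precedes it below -/
import Mathlib

section
/- For every γ = (a b; c d) ∈ SL(2, ℤ) and every z in the upper half-plane ℍ: Φ12(x1(γz),…,x6(γz)) = (cz+d)^12 · Φ12(x1(z),…,x6(z)), where γz = (az+b)/(cz+d); i.e., z ↦ Φ12(x1(z),…,x6(z)) transforms as a modular form of weight 12 for the full modular group SL(2, ℤ). -/
open Complex Finset

noncomputable section

/-- `ζ = exp(2πi/13)`. -/
def zeta13 : ℂ := Complex.exp (2 * Real.pi * Complex.I / 13)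

local notation "ζ" => zeta13

/-- The diagonal matrix `T = diag(ζ^7, ζ^11, ζ^8, ζ^6, ζ^2, ζ^5)`. -/
def Tmat : Matrix (Fin 6) (Fin 6) ℂ :=
  Matrix.diagonal ![ζ ^ 7, ζ ^ 11, ζ ^ 8, ζ ^ 6, ζ ^ 2, ζ ^ 5]

/-- The matrix `S = -(1/√13)·M`. -/
def Smat : Matrix (Fin 6) (Fin 6) ℂ :=
  (-(1 / (Real.sqrt 13 : ℂ))) • Matrix.of
    ![![ζ^12 - ζ, ζ^10 - ζ^3, ζ^4 - ζ^9, ζ^5 - ζ^8, ζ^2 - ζ^11, ζ^6 - ζ^7],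
      ![ζ^10 - ζ^3, ζ^4 - ζ^9, ζ^12 - ζ, ζ^2 - ζ^11, ζ^6 - ζ^7, ζ^5 - ζ^8],
      ![ζ^4 - ζ^9, ζ^12 - ζ, ζ^10 - ζ^3, ζ^6 - ζ^7, ζ^5 - ζ^8, ζ^2 - ζ^11],
      ![ζ^5 - ζ^8, ζ^2 - ζ^11, ζ^6 - ζ^7, ζ - ζ^12, ζ^3 - ζ^10, ζ^9 - ζ^4],
      ![ζ^2 - ζ^11, ζ^6 - ζ^7, ζ^5 - ζ^8, ζ^3 - ζ^10, ζ^9 - ζ^4, ζ - ζ^12],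
      ![ζ^6 - ζ^7, ζ^5 - ζ^8, ζ^2 - ζ^11, ζ^9 - ζ^4, ζ - ζ^12, ζ^3 - ζ^10]]

/-- The matrix `H`, mapping `(z1,…,z6)` to `(z6, z4, z5, −z3, −z1, −z2)`. -/
def Hmat : Matrix (Fin 6) (Fin 6) ℂ :=
  Matrix.of
    ![![0,0,0,0,0,1], ![0,0,0,1,0,0], ![0,0,0,0,1,0],
      ![0,0,-1,0,0,0], ![-1,0,0,0,0,0], ![0,-1,0,0,0,0]]

/-- The senary quadratic forms `A_0, …, A_6` (here `v 0 = z1, …, v 5 = z6`). -/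
def A : ℕ → (Fin 6 → ℂ) → ℂ
  | 0, v => v 0 * v 3 + v 1 * v 4 + v 2 * v 5
  | 1, v => v 0 ^ 2 - 2 * v 2 * v 3
  | 2, v => -v 4 ^ 2 - 2 * v 1 * v 3
  | 3, v => v 1 ^ 2 - 2 * v 0 * v 4
  | 4, v => v 2 ^ 2 - 2 * v 1 * v 5
  | 5, v => -v 3 ^ 2 - 2 * v 0 * v 5
  | 6, v => -v 5 ^ 2 - 2 * v 2 * v 4
  | _, _ => 0

/-- `w_ν = (A0 + ζ^ν A1 + ζ^{4ν} A2 + ζ^{9ν} A3 + ζ^{3ν} A4 + ζ^{12ν} A5 + ζ^{10ν} A6)^2`. -/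
def w (ν : ℕ) (v : Fin 6 → ℂ) : ℂ :=
  (A 0 v + ζ ^ ν * A 1 v + ζ ^ (4 * ν) * A 2 v + ζ ^ (9 * ν) * A 3 v +
    ζ ^ (3 * ν) * A 4 v + ζ ^ (12 * ν) * A 5 v + ζ ^ (10 * ν) * A 6 v) ^ 2

/-- `w_∞ = 13·A0^2`. -/
def winf (v : Fin 6 → ℂ) : ℂ := 13 * A 0 v ^ 2

/-- The senary cubic forms `D_0, …, D_12` (here `v 0 = z1, …, v 5 = z6`). -/
def D : ℕ → (Fin 6 → ℂ) → ℂ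
  | 0, v => v 0 * v 1 * v 2
  | 1, v => 2 * v 1 * v 2 ^ 2 + v 1 ^ 2 * v 5 - v 3 ^ 2 * v 4 + v 0 * v 4 * v 5
  | 2, v => -v 5 ^ 3 + v 1 ^ 2 * v 3 - 2 * v 1 * v 4 ^ 2 + v 0 * v 3 * v 4 + 3 * v 2 * v 4 * v 5
  | 3, v => 2 * v 0 * v 1 ^ 2 + v 0 ^ 2 * v 4 - v 3 * v 5 ^ 2 + v 2 * v 3 * v 4
  | 4, v => -v 1 ^ 2 * v 2 + v 0 * v 5 ^ 2 - 2 * v 3 ^ 2 * v 5 - v 0 * v 2 * v 4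
  | 5, v => -v 3 ^ 3 + v 2 ^ 2 * v 4 - 2 * v 2 * v 5 ^ 2 + v 1 * v 4 * v 5 + 3 * v 0 * v 3 * v 5
  | 6, v => -v 4 ^ 3 + v 0 ^ 2 * v 5 - 2 * v 0 * v 3 ^ 2 + v 2 * v 3 * v 5 + 3 * v 1 * v 3 * v 4
  | 7, v => -v 1 ^ 3 + v 2 * v 3 ^ 2 - v 0 * v 2 * v 5 - 3 * v 0 * v 1 * v 4 + 2 * v 0 ^ 2 * v 3
  | 8, v => -v 0 ^ 3 + v 1 * v 5 ^ 2 - v 1 * v 2 * v 4 - 3 * v 0 * v 2 * v 3 + 2 * v 2 ^ 2 * v 5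
  | 9, v => 2 * v 0 ^ 2 * v 2 + v 2 ^ 2 * v 3 - v 4 ^ 2 * v 5 + v 1 * v 3 * v 5
  | 10, v => -v 0 * v 2 ^ 2 + v 1 * v 3 ^ 2 - 2 * v 3 * v 4 ^ 2 - v 0 * v 1 * v 5
  | 11, v => -v 2 ^ 3 + v 0 * v 4 ^ 2 - v 0 * v 1 * v 3 - 3 * v 1 * v 2 * v 5 + 2 * v 1 ^ 2 * v 4
  | 12, v => -v 0 ^ 2 * v 1 + v 2 * v 4 ^ 2 - 2 * v 4 * v 5 ^ 2 - v 1 * v 2 * v 3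
  | _, _ => 0

/-- The senary cubic form `D_∞ = z4 z5 z6`. -/
def Dinf (v : Fin 6 → ℂ) : ℂ := v 3 * v 4 * v 5

/-- The senary sextic forms `G_0, …, G_12`. -/
def Gs : ℕ → (Fin 6 → ℂ) → ℂ
  | 0, v => D 0 v ^ 2 + Dinf v ^ 2
  | 1, v => -D 7 v ^ 2 + 2 * D 0 v * D 1 v + 10 * Dinf v * D 1 v + 2 * D 2 v * D 12 v
      - 2 * D 3 v * D 11 v - 4 * D 4 v * D 10 v - 2 * D 9 v * D 5 v
  | 2, v => -2 * D 1 v ^ 2 - 4 * D 0 v * D 2 v + 6 * Dinf v * D 2 v - 2 * D 4 v * D 11 v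
      + 2 * D 5 v * D 10 v - 2 * D 6 v * D 9 v - 2 * D 7 v * D 8 v
  | 3, v => -D 8 v ^ 2 + 2 * D 0 v * D 3 v + 10 * Dinf v * D 3 v + 2 * D 6 v * D 10 v
      - 2 * D 9 v * D 7 v - 4 * D 12 v * D 4 v - 2 * D 1 v * D 2 v
  | 4, v => -D 2 v ^ 2 + 10 * D 0 v * D 4 v - 2 * Dinf v * D 4 v + 2 * D 5 v * D 12 v
      - 2 * D 9 v * D 8 v - 4 * D 1 v * D 3 v - 2 * D 10 v * D 7 v
  | 5, v => -2 * D 9 v ^ 2 - 4 * D 0 v * D 5 v + 6 * Dinf v * D 5 v - 2 * D 10 v * D 8 v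
      + 2 * D 6 v * D 12 v - 2 * D 2 v * D 3 v - 2 * D 11 v * D 7 v
  | 6, v => -2 * D 3 v ^ 2 - 4 * D 0 v * D 6 v + 6 * Dinf v * D 6 v - 2 * D 12 v * D 7 v
      + 2 * D 2 v * D 4 v - 2 * D 5 v * D 1 v - 2 * D 8 v * D 11 v
  | 7, v => -2 * D 10 v ^ 2 + 6 * D 0 v * D 7 v + 4 * Dinf v * D 7 v - 2 * D 1 v * D 6 v
      - 2 * D 2 v * D 5 v - 2 * D 8 v * D 12 v - 2 * D 9 v * D 11 v
  | 8, v => -2 * D 4 v ^ 2 + 6 * D 0 v * D 8 v + 4 * Dinf v * D 8 v - 2 * D 3 v * D 5 v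
      - 2 * D 6 v * D 2 v - 2 * D 11 v * D 10 v - 2 * D 1 v * D 7 v
  | 9, v => -D 11 v ^ 2 + 2 * D 0 v * D 9 v + 10 * Dinf v * D 9 v + 2 * D 5 v * D 4 v
      - 2 * D 1 v * D 8 v - 4 * D 10 v * D 12 v - 2 * D 3 v * D 6 v
  | 10, v => -D 5 v ^ 2 + 10 * D 0 v * D 10 v - 2 * Dinf v * D 10 v + 2 * D 6 v * D 4 v
      - 2 * D 3 v * D 7 v - 4 * D 9 v * D 1 v - 2 * D 12 v * D 11 v
  | 11, v => -2 * D 12 v ^ 2 + 6 * D 0 v * D 11 v + 4 * Dinf v * D 11 v - 2 * D 9 v * D 2 v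
      - 2 * D 5 v * D 6 v - 2 * D 7 v * D 4 v - 2 * D 3 v * D 8 v
  | 12, v => -D 6 v ^ 2 + 10 * D 0 v * D 12 v - 2 * Dinf v * D 12 v + 2 * D 2 v * D 10 v
      - 2 * D 1 v * D 11 v - 4 * D 3 v * D 9 v - 2 * D 4 v * D 8 v
  | _, _ => 0

/-- `δ_ν = −13·G0 + Σ_{j=1}^{12} ζ^{jν} G_j`. -/
def deltaF (ν : ℕ) (v : Fin 6 → ℂ) : ℂ :=
  -13 * Gs 0 v + ∑ j ∈ Finset.Icc 1 12, ζ ^ (j * ν) * Gs j v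

/-- `δ_∞ = 13^2·G0`. -/
def deltaInf (v : Fin 6 → ℂ) : ℂ := 13 ^ 2 * Gs 0 v

/-- `Φ4 = Σ_ν w_ν + w_∞`. -/
def Phi4 (v : Fin 6 → ℂ) : ℂ := (∑ ν ∈ Finset.range 13, w ν v) + winf v

/-- `Φ8 = Σ_ν w_ν^2 + w_∞^2`. -/
def Phi8 (v : Fin 6 → ℂ) : ℂ := (∑ ν ∈ Finset.range 13, w ν v ^ 2) + winf v ^ 2

/-- `Φ12′ = −(1/(13·30))(Σ_ν w_ν^3 + w_∞^3)`. -/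
def Phi12' (v : Fin 6 → ℂ) : ℂ :=
  -(1 / (13 * 30)) * ((∑ ν ∈ Finset.range 13, w ν v ^ 3) + winf v ^ 3)

/-- `Φ16 = Σ_ν w_ν^4 + w_∞^4`. -/
def Phi16 (v : Fin 6 → ℂ) : ℂ := (∑ ν ∈ Finset.range 13, w ν v ^ 4) + winf v ^ 4

/-- `Φ20 = (1/(13·25))(Σ_ν w_ν^5 + w_∞^5)`. -/
def Phi20 (v : Fin 6 → ℂ) : ℂ :=
  (1 / (13 * 25)) * ((∑ ν ∈ Finset.range 13, w ν v ^ 5) + winf v ^ 5)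

/-- `Φ12 = −(1/(13·52))(Σ_ν δ_ν^2 + δ_∞^2)`. -/
def Phi12 (v : Fin 6 → ℂ) : ℂ :=
  -(1 / (13 * 52)) * ((∑ ν ∈ Finset.range 13, deltaF ν v ^ 2) + deltaInf v ^ 2)

/-- `Φ18 = (1/(13·6))(Σ_ν δ_ν^3 + δ_∞^3)`. -/
def Phi18 (v : Fin 6 → ℂ) : ℂ :=
  (1 / (13 * 6)) * ((∑ ν ∈ Finset.range 13, deltaF ν v ^ 3) + deltaInf v ^ 3)

/-- `Φ30 = −(1/(13·1315))(Σ_ν δ_ν^5 + δ_∞^5)`. -/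
def Phi30 (v : Fin 6 → ℂ) : ℂ :=
  -(1 / (13 * 1315)) * ((∑ ν ∈ Finset.range 13, deltaF ν v ^ 5) + deltaInf v ^ 5)

/-- `q^α = exp(2πiαz)`. -/
def qp (α : ℚ) (z : ℂ) : ℂ := Complex.exp (2 * Real.pi * Complex.I * (α : ℂ) * z)

/-- `Σ_{n∈ℤ} (−1)^n q^{(13n^2+cn)/2}`. -/
def thetaSum (c : ℤ) (z : ℂ) : ℂ :=
  ∑' n : ℤ, (-1 : ℂ) ^ n * qp ((13 * (n : ℚ) ^ 2 + (c : ℚ) * (n : ℚ)) / 2) z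

/-- The theta constants of order 13: `a_1, …, a_6`. -/
def thc : ℕ → ℂ → ℂ
  | 1, z => qp (121 / 104) z * thetaSum 11 z
  | 2, z => qp (49 / 104) z * thetaSum 7 z
  | 3, z => qp (25 / 104) z * thetaSum 5 z
  | 4, z => -(qp (9 / 104) z * thetaSum 3 z)
  | 5, z => qp (81 / 104) z * thetaSum 9 z
  | 6, z => qp (1 / 104) z * thetaSum 1 z
  | _, _ => 0

/-- The vector `A(z) = (a1(z), …, a6(z))`. -/
def Avec (z : ℂ) : Fin 6 → ℂ := fun i => thc (i.val + 1) z

/-- The Dedekind eta function `η(z) = q^{1/24} Π_{n=1}^∞ (1−q^n)`. -/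
def etaF (z : ℂ) : ℂ :=
  qp (1 / 24) z * ∏' n : ℕ, (1 - Complex.exp (2 * Real.pi * Complex.I * z) ^ (n + 1))

/-- The vector `(x1(z), …, x6(z))` with `x_i(z) = η(z)·a_i(z)`. -/
def X (z : ℂ) : Fin 6 → ℂ := fun i => etaF z * thc (i.val + 1) z

/-- The discriminant `Δ(z) = η(z)^24`. -/
def Delta (z : ℂ) : ℂ := etaF z ^ 24

/-- The Eisenstein series `E4(z) = (1/2) Σ_{gcd(m,n)=1} (mz+n)^{−4}`. -/
def E4 (z : ℂ) : ℂ :=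
  (1 / 2) * ∑' p : {p : ℤ × ℤ // Int.gcd p.1 p.2 = 1},
    ((p.1.1 : ℂ) * z + (p.1.2 : ℂ)) ^ (-4 : ℤ)

/-- The Eisenstein series `E6(z) = (1/2) Σ_{gcd(m,n)=1} (mz+n)^{−6}`. -/
def E6 (z : ℂ) : ℂ :=
  (1 / 2) * ∑' p : {p : ℤ × ℤ // Int.gcd p.1 p.2 = 1},
    ((p.1.1 : ℂ) * z + (p.1.2 : ℂ)) ^ (-6 : ℤ)

/-- The difference of two of the cubic Gaussian periods at a thirteenth root of unity `w`. -/
def periodDiff (w : ℂ) : ℂ := w + w ^ 3 + w ^ 9 - w ^ 4 - w ^ 10 - w ^ 12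

/-- The difference of the other two cubic Gaussian periods at `w`. -/
def periodDiff' (w : ℂ) : ℂ := w ^ 2 + w ^ 5 + w ^ 6 - w ^ 7 - w ^ 8 - w ^ 11

/-- The finite Fourier transform on odd functions on `ℤ/13`, with respect to the root of
unity `w`, in the coordinates of `Smat`. -/
def oddFourier (w : ℂ) (v : Fin 6 → ℂ) : Fin 6 → ℂ :=
  ![(w ^ 12 - w) * v 0 + (w ^ 10 - w ^ 3) * v 1 + (w ^ 4 - w ^ 9) * v 2 +
      (w ^ 5 - w ^ 8) * v 3 + (w ^ 2 - w ^ 11) * v 4 + (w ^ 6 - w ^ 7) * v 5,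
    (w ^ 10 - w ^ 3) * v 0 + (w ^ 4 - w ^ 9) * v 1 + (w ^ 12 - w) * v 2 +
      (w ^ 2 - w ^ 11) * v 3 + (w ^ 6 - w ^ 7) * v 4 + (w ^ 5 - w ^ 8) * v 5,
    (w ^ 4 - w ^ 9) * v 0 + (w ^ 12 - w) * v 1 + (w ^ 10 - w ^ 3) * v 2 +
      (w ^ 6 - w ^ 7) * v 3 + (w ^ 5 - w ^ 8) * v 4 + (w ^ 2 - w ^ 11) * v 5,
    (w ^ 5 - w ^ 8) * v 0 + (w ^ 2 - w ^ 11) * v 1 + (w ^ 6 - w ^ 7) * v 2 +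
      (w - w ^ 12) * v 3 + (w ^ 3 - w ^ 10) * v 4 + (w ^ 9 - w ^ 4) * v 5,
    (w ^ 2 - w ^ 11) * v 0 + (w ^ 6 - w ^ 7) * v 1 + (w ^ 5 - w ^ 8) * v 2 +
      (w ^ 3 - w ^ 10) * v 3 + (w ^ 9 - w ^ 4) * v 4 + (w - w ^ 12) * v 5,
    (w ^ 6 - w ^ 7) * v 0 + (w ^ 5 - w ^ 8) * v 1 + (w ^ 2 - w ^ 11) * v 2 +
      (w ^ 9 - w ^ 4) * v 3 + (w - w ^ 12) * v 4 + (w ^ 3 - w ^ 10) * v 5]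

theorem periodDiff_sq_add {w : ℂ} (hw : ∑ k ∈ range 13, w ^ k = 0) :
    periodDiff w ^ 2 + periodDiff' w ^ 2 = -13 := by
  simp only [sum_range_succ, sum_range_zero] at hw
  simp only [periodDiff, periodDiff']
  linear_combination (13 - 13 * w + w ^ 2 - w ^ 3 + 3 * w ^ 4 - 5 * w ^ 5 + 3 * w ^ 6 - w ^ 7 +
    3 * w ^ 8 - 5 * w ^ 9 + 3 * w ^ 10 - w ^ 11 + w ^ 12) * hw

theorem D_zero_oddFourier {w : ℂ} (hw : ∑ k ∈ range 13, w ^ k = 0) (v : Fin 6 → ℂ) :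
    D 0 (oddFourier w v) =
      (2 * periodDiff w - 3 * periodDiff' w) * D 0 v
        - (3 * periodDiff w + 2 * periodDiff' w) * Dinf v
        + (periodDiff w + periodDiff' w) * (D 1 v + D 3 v + D 9 v)
        + periodDiff w * (D 2 v + D 5 v + D 6 v)
        + (periodDiff' w - periodDiff w) * (D 4 v + D 10 v + D 12 v)
        + periodDiff' w * (D 7 v + D 8 v + D 11 v) := by
  simp only [sum_range_succ, sum_range_zero] at hw
  obtain ⟨a, ha⟩ : ∃ x, x = w ^ 12 - w := ⟨_, rfl⟩
  obtain ⟨b, hb⟩ : ∃ x, x = w ^ 10 - w ^ 3 := ⟨_, rfl⟩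
  obtain ⟨c, hc⟩ : ∃ x, x = w ^ 4 - w ^ 9 := ⟨_, rfl⟩
  obtain ⟨d, hd⟩ : ∃ x, x = w ^ 5 - w ^ 8 := ⟨_, rfl⟩
  obtain ⟨e, he⟩ : ∃ x, x = w ^ 2 - w ^ 11 := ⟨_, rfl⟩
  obtain ⟨f, hf⟩ : ∃ x, x = w ^ 6 - w ^ 7 := ⟨_, rfl⟩
  obtain ⟨s, hs⟩ : ∃ x, x = periodDiff w := ⟨_, rfl⟩
  obtain ⟨t, ht⟩ : ∃ x, x = periodDiff' w := ⟨_, rfl⟩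
  have r0 : a * b * c = - t := by
    simp only [ha, hb, hc, ht, periodDiff']
    linear_combination (w ^ 2 - w ^ 3 + w ^ 5 - 2 * w ^ 7 + w ^ 8 - w ^ 11 + w ^ 12 - w ^ 13 + w
      ^ 14 + w ^ 18 - w ^ 19) * hw
  have r1 : a * a * b + a * c * c + b * b * c = s - t := by
    simp only [ha, hb, hc, hs, ht, periodDiff, periodDiff']
    linear_combination (- w + 2 * w ^ 2 - 2 * w ^ 3 + 2 * w ^ 4 - w ^ 5 + w ^ 6 - 2 * w ^ 7 - w
      ^ 9 + 4 * w ^ 10 - 3 * w ^ 11 + 3 * w ^ 12 - 2 * w ^ 13 + w ^ 14 - w ^ 15 + w ^ 16 - 2 * w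
      ^ 17 + w ^ 18 - w ^ 21 + w ^ 22) * hw
  have r2 : a * a * c + a * b * b + b * c * c = 2 * s + 2 * t := by
    simp only [ha, hb, hc, hs, ht, periodDiff, periodDiff']
    linear_combination (- 2 * w + 4 * w ^ 4 - 4 * w ^ 5 + w ^ 6 + 2 * w ^ 7 + w ^ 8 - 4 * w ^ 9
      + 4 * w ^ 10 - 2 * w ^ 11 + 2 * w ^ 12 - 2 * w ^ 13 - 2 * w ^ 15 + 2 * w ^ 16 - w ^ 19 + 2
      * w ^ 20 - w ^ 21) * hw
  have r3 : a * b * f + a * c * e + b * c * d = 2 * t := by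
    simp only [ha, hb, hc, hd, he, hf, ht, periodDiff']
    linear_combination (- 2 * w ^ 2 + 2 * w ^ 3 - 2 * w ^ 5 + 3 * w ^ 7 + w ^ 8 - 2 * w ^ 9 + w
      ^ 10 - w ^ 12 - w ^ 15 + 2 * w ^ 16 - w ^ 17 - w ^ 19 + w ^ 20) * hw
  have r4 : a * b * d + a * c * f + b * c * e = s + t := by
    simp only [ha, hb, hc, hd, he, hf, hs, ht, periodDiff, periodDiff']
    linear_combination (- w + 2 * w ^ 4 - 2 * w ^ 5 + 2 * w ^ 7 - 2 * w ^ 9 + 2 * w ^ 10 - w ^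
      11 + w ^ 12 - w ^ 13 - w ^ 15 + w ^ 16) * hw
  have r5 : a * b * e + a * c * d + b * c * f = s := by
    simp only [ha, hb, hc, hd, he, hf, hs, periodDiff]
    linear_combination (- w + w ^ 2 - w ^ 3 + 2 * w ^ 4 - w ^ 5 + w ^ 6 - w ^ 7 - w ^ 9 + w ^ 10
      + w ^ 12 - 2 * w ^ 13 + w ^ 14 - w ^ 16 + w ^ 17 + w ^ 20 - w ^ 21) * hw
  have r6 : a * a * a + 3 * a * b * c + b * b * b + c * c * c = 2 * s - 3 * t := by
    simp only [ha, hb, hc, hs, ht, periodDiff, periodDiff']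
    linear_combination (- 2 * w + 5 * w ^ 2 - 6 * w ^ 3 + 5 * w ^ 4 + w ^ 5 - 6 * w ^ 7 + 3 * w
      ^ 8 - 3 * w ^ 9 + 5 * w ^ 10 - 5 * w ^ 11 + 6 * w ^ 12 - 6 * w ^ 13 + 4 * w ^ 14 - w ^ 15
      - w ^ 17 + 4 * w ^ 18 - 3 * w ^ 19 - w ^ 23 + w ^ 24) * hw
  have r7 : a * a * e + a * b * d + a * c * f + b * b * f + b * c * e + c * c * d = - t := by
    simp only [ha, hb, hc, hd, he, hf, ht, periodDiff']
    linear_combination (w ^ 2 - w ^ 3 + w ^ 4 - 2 * w ^ 7 + w ^ 9 - 2 * w ^ 11 + 3 * w ^ 12 - 2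
      * w ^ 13 + 2 * w ^ 14 - 2 * w ^ 15 + w ^ 16 + w ^ 22 - w ^ 23) * hw
  have r8 : a * a * f + a * b * e + a * c * d + b * b * d + b * c * f + c * c * e = - 3 * t :=
    by
    simp only [ha, hb, hc, hd, he, hf, ht, periodDiff']
    linear_combination (3 * w ^ 2 - 3 * w ^ 3 + 3 * w ^ 5 + w ^ 6 - 7 * w ^ 7 + w ^ 8 + w ^ 9 +
      w ^ 10 - 2 * w ^ 11 + 2 * w ^ 12 - w ^ 13 + w ^ 14 + w ^ 15 - w ^ 16 - w ^ 17 + 2 * w ^ 18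
      - w ^ 19 + w ^ 20 - w ^ 21) * hw
  have r9 : a * a * d + a * b * f + a * c * e + b * b * e + b * c * d + c * c * f = s - t := by
    simp only [ha, hb, hc, hd, he, hf, hs, ht, periodDiff, periodDiff']
    linear_combination (- w + 2 * w ^ 2 - 2 * w ^ 3 + 2 * w ^ 4 - 2 * w ^ 7 + w ^ 8 - w ^ 9 + 2
      * w ^ 10 - 3 * w ^ 11 + 3 * w ^ 12 - w ^ 13 - w ^ 15 + w ^ 16 + w ^ 18 - w ^ 19) * hw
  have r10 : a * e * f + b * d * f + c * d * e = - 2 * s := by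
    simp only [ha, hb, hc, hd, he, hf, hs, periodDiff]
    linear_combination (2 * w - 2 * w ^ 2 + 2 * w ^ 3 - 4 * w ^ 4 + 2 * w ^ 5 + w ^ 9 - 2 * w ^
      10 + 2 * w ^ 11 - 3 * w ^ 12 + 2 * w ^ 13 + w ^ 15 - 2 * w ^ 17 + w ^ 18) * hw
  have r11 : a * d * e + a * f * f + b * d * d + b * e * f + c * d * f + c * e * e = s := by
    simp only [ha, hb, hc, hd, he, hf, hs, periodDiff]
    linear_combination (- w + w ^ 2 - w ^ 3 + 2 * w ^ 4 - w ^ 5 - w ^ 9 + 2 * w ^ 10 - w ^ 11 +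
      2 * w ^ 12 - 5 * w ^ 13 + 4 * w ^ 14 - w ^ 15) * hw
  have r12 : a * d * f + a * e * e + b * d * e + b * f * f + c * d * d + c * e * f = 3 * s := by
    simp only [ha, hb, hc, hd, he, hf, hs, periodDiff]
    linear_combination (- 3 * w + 3 * w ^ 2 - 3 * w ^ 3 + 6 * w ^ 4 - 4 * w ^ 5 + w ^ 6 - 3 * w
      ^ 9 + 5 * w ^ 10 - 2 * w ^ 11 + 3 * w ^ 12 - 2 * w ^ 13 - w ^ 14 - w ^ 16 + w ^ 17 - w ^
      21 + w ^ 22) * hw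
  have r13 : a * d * f + b * d * e + c * e * f = t := by
    simp only [ha, hb, hc, hd, he, hf, ht, periodDiff']
    linear_combination (- w ^ 2 + w ^ 3 - w ^ 5 + 2 * w ^ 7 - w ^ 9 - w ^ 10 + 2 * w ^ 11 - w ^
      12 + w ^ 13 - w ^ 14 - w ^ 16 + w ^ 17) * hw
  have r14 : a * d * d + a * e * f + b * d * f + b * e * e + c * d * e + c * f * f = s + t := by
    simp only [ha, hb, hc, hd, he, hf, hs, ht, periodDiff, periodDiff']
    linear_combination (- w + 2 * w ^ 4 - 2 * w ^ 5 + w ^ 7 + w ^ 8 - 3 * w ^ 9 + 4 * w ^ 10 - w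
      ^ 11 - w ^ 13 + w ^ 16 - 2 * w ^ 17 + w ^ 18 - w ^ 19 + w ^ 20) * hw
  have r15 : a * d * e + b * e * f + c * d * f = - s + t := by
    simp only [ha, hb, hc, hd, he, hf, hs, ht, periodDiff, periodDiff']
    linear_combination (w - 2 * w ^ 2 + 2 * w ^ 3 - 2 * w ^ 4 + 2 * w ^ 7 - w ^ 8 + w ^ 9 - 2 *
      w ^ 10 + 2 * w ^ 11 - w ^ 12 + w ^ 14 - w ^ 15 - w ^ 18 + w ^ 19) * hw
  have r16 : d * e * f = - s := by
    simp only [hd, he, hf, hs, periodDiff]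
    linear_combination (w - w ^ 2 + w ^ 3 - 2 * w ^ 4 + w ^ 5 + w ^ 9 - 2 * w ^ 10 + w ^ 11 - w
      ^ 12 + 2 * w ^ 13 - w ^ 14) * hw
  have r17 : d * d * e + d * f * f + e * e * f = - s - t := by
    simp only [hd, he, hf, hs, ht, periodDiff, periodDiff']
    linear_combination (w - 2 * w ^ 4 + 2 * w ^ 5 - 2 * w ^ 7 + 2 * w ^ 9 - w ^ 10 - 2 * w ^ 11
      + 2 * w ^ 12 + w ^ 14 - 2 * w ^ 15 + 2 * w ^ 16 - w ^ 17) * hw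
  have r18 : d * d * f + d * e * e + e * f * f = 2 * s - 2 * t := by
    simp only [hd, he, hf, hs, ht, periodDiff, periodDiff']
    linear_combination (- 2 * w + 4 * w ^ 2 - 4 * w ^ 3 + 4 * w ^ 4 - 4 * w ^ 7 + w ^ 9 + 3 * w
      ^ 10 - 4 * w ^ 11 + 3 * w ^ 12 - w ^ 13 - w ^ 14 + w ^ 15 + w ^ 17 - w ^ 18) * hw
  have r19 : d * d * d + 3 * d * e * f + e * e * e + f * f * f = - 3 * s - 2 * t := by
    simp only [hd, he, hf, hs, ht, periodDiff, periodDiff']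
    linear_combination (3 * w - w ^ 2 + w ^ 3 - 6 * w ^ 4 + 5 * w ^ 5 + w ^ 6 - 5 * w ^ 7 + 5 *
      w ^ 9 - 6 * w ^ 10 + w ^ 11 - w ^ 12 + 6 * w ^ 13 - 3 * w ^ 14 + w ^ 20 - w ^ 21) * hw
  simp only [D, Dinf, oddFourier, Matrix.cons_val, ← ha, ← hb, ← hc, ← hd, ← he, ← hf, ← hs, ← ht]
  linear_combination (v 0 * v 0 * v 0 + v 1 * v 1 * v 1 + v 2 * v 2 * v 2) * r0 + (v 0 * v 0 * v
    1 + v 0 * v 2 * v 2 + v 1 * v 1 * v 2) * r1 + (v 0 * v 0 * v 2 + v 0 * v 1 * v 1 + v 1 * v 2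
    * v 2) * r2 + (v 0 * v 0 * v 3 + v 1 * v 1 * v 4 + v 2 * v 2 * v 5) * r3 + (v 0 * v 0 * v 4
    + v 1 * v 1 * v 5 + v 2 * v 2 * v 3) * r4 + (v 0 * v 0 * v 5 + v 1 * v 1 * v 3 + v 2 * v 2 *
    v 4) * r5 + v 0 * v 1 * v 2 * r6 + (v 0 * v 1 * v 3 + v 0 * v 2 * v 5 + v 1 * v 2 * v 4) *
    r7 + (v 0 * v 1 * v 4 + v 0 * v 2 * v 3 + v 1 * v 2 * v 5) * r8 + (v 0 * v 1 * v 5 + v 0 * v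
    2 * v 4 + v 1 * v 2 * v 3) * r9 + (v 0 * v 3 * v 3 + v 1 * v 4 * v 4 + v 2 * v 5 * v 5) *
    r10 + (v 0 * v 3 * v 4 + v 1 * v 4 * v 5 + v 2 * v 3 * v 5) * r11 + (v 0 * v 3 * v 5 + v 1 *
    v 3 * v 4 + v 2 * v 4 * v 5) * r12 + (v 0 * v 4 * v 4 + v 1 * v 5 * v 5 + v 2 * v 3 * v 3) *
    r13 + (v 0 * v 4 * v 5 + v 1 * v 3 * v 5 + v 2 * v 3 * v 4) * r14 + (v 0 * v 5 * v 5 + v 1 *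
    v 3 * v 3 + v 2 * v 4 * v 4) * r15 + (v 3 * v 3 * v 3 + v 4 * v 4 * v 4 + v 5 * v 5 * v 5) *
    r16 + (v 3 * v 3 * v 4 + v 3 * v 5 * v 5 + v 4 * v 4 * v 5) * r17 + (v 3 * v 3 * v 5 + v 3 *
    v 4 * v 4 + v 4 * v 5 * v 5) * r18 + v 3 * v 4 * v 5 * r19

/-- The action of `Tmat`, with an arbitrary thirteenth root of unity `w` in place of `ζ`. -/
def twist (w : ℂ) (v : Fin 6 → ℂ) : Fin 6 → ℂ :=
  ![w ^ 7 * v 0, w ^ 11 * v 1, w ^ 8 * v 2, w ^ 6 * v 3, w ^ 2 * v 4, w ^ 5 * v 5]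

theorem Dinf_twist {w : ℂ} (hw : w ^ 13 = 1) (v : Fin 6 → ℂ) : Dinf (twist w v) = Dinf v := by
  simp only [Dinf, twist, Matrix.cons_val]
  linear_combination v 3 * v 4 * v 5 * hw

theorem D_twist {w : ℂ} (hw : w ^ 13 = 1) (v : Fin 6 → ℂ) {j : ℕ} (hj : j < 13) :
    D j (twist w v) = w ^ j * D j v := by
  interval_cases j <;> simp only [D, twist, Matrix.cons_val]
  · linear_combination (v 0 * v 1 * v 2 * (1 + w ^ 13)) * hw
  · linear_combination (2 * v 1 * v 2 ^ 2 * w * (1 + w ^ 13) + v 1 ^ 2 * v 5 * w * (1 + w ^ 13)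
      - v 3 ^ 2 * v 4 * w + v 0 * v 4 * v 5 * w) * hw
  · linear_combination (-v 5 ^ 3 * w ^ 2 + v 1 ^ 2 * v 3 * w ^ 2 * (1 + w ^ 13) - 2 * v 1 * v 4
      ^ 2 * w ^ 2 + v 0 * v 3 * v 4 * w ^ 2 + 3 * v 2 * v 4 * v 5 * w ^ 2) * hw
  · linear_combination (2 * v 0 * v 1 ^ 2 * w ^ 3 * (1 + w ^ 13) + v 0 ^ 2 * v 4 * w ^ 3 - v 3 *
      v 5 ^ 2 * w ^ 3 + v 2 * v 3 * v 4 * w ^ 3) * hw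
  · linear_combination (-v 1 ^ 2 * v 2 * w ^ 4 * (1 + w ^ 13) + v 0 * v 5 ^ 2 * w ^ 4 - 2 * v 3
      ^ 2 * v 5 * w ^ 4 - v 0 * v 2 * v 4 * w ^ 4) * hw
  · linear_combination (-v 3 ^ 3 * w ^ 5 + v 2 ^ 2 * v 4 * w ^ 5 - 2 * v 2 * v 5 ^ 2 * w ^ 5 + v
      1 * v 4 * v 5 * w ^ 5 + 3 * v 0 * v 3 * v 5 * w ^ 5) * hw
  · linear_combination (v 0 ^ 2 * v 5 * w ^ 6 - 2 * v 0 * v 3 ^ 2 * w ^ 6 + v 2 * v 3 * v 5 * w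
      ^ 6 + 3 * v 1 * v 3 * v 4 * w ^ 6) * hw
  · linear_combination (-v 1 ^ 3 * w ^ 7 * (1 + w ^ 13) + v 2 * v 3 ^ 2 * w ^ 7 - v 0 * v 2 * v
      5 * w ^ 7 - 3 * v 0 * v 1 * v 4 * w ^ 7 + 2 * v 0 ^ 2 * v 3 * w ^ 7) * hw
  · linear_combination (-v 0 ^ 3 * w ^ 8 + v 1 * v 5 ^ 2 * w ^ 8 - v 1 * v 2 * v 4 * w ^ 8 - 3 *
      v 0 * v 2 * v 3 * w ^ 8 + 2 * v 2 ^ 2 * v 5 * w ^ 8) * hw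
  · linear_combination (2 * v 0 ^ 2 * v 2 * w ^ 9 + v 2 ^ 2 * v 3 * w ^ 9 + v 1 * v 3 * v 5 * w
      ^ 9) * hw
  · linear_combination (-v 0 * v 2 ^ 2 * w ^ 10 + v 1 * v 3 ^ 2 * w ^ 10 - v 0 * v 1 * v 5 * w ^
      10) * hw
  · linear_combination (-v 2 ^ 3 * w ^ 11 - v 0 * v 1 * v 3 * w ^ 11 - 3 * v 1 * v 2 * v 5 * w ^
      11 + 2 * v 1 ^ 2 * v 4 * w ^ 11) * hw
  · linear_combination (-v 0 ^ 2 * v 1 * w ^ 12 - v 1 * v 2 * v 3 * w ^ 12) * hw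

theorem Gs_twist {w : ℂ} (hw : w ^ 13 = 1) (v : Fin 6 → ℂ) {j : ℕ} (hj : j < 13) :
    Gs j (twist w v) = w ^ j * Gs j v := by
  interval_cases j <;>
    simp (disch := norm_num only) only [Gs, D_twist hw v, Dinf_twist hw v]
  · ring
  · linear_combination (-D 7 v ^ 2 * w + 2 * D 2 v * D 12 v * w - 2 * D 3 v * D 11 v * w - 4 * D
      4 v * D 10 v * w - 2 * D 9 v * D 5 v * w) * hw
  · linear_combination (-2 * D 4 v * D 11 v * w ^ 2 + 2 * D 5 v * D 10 v * w ^ 2 - 2 * D 6 v * D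
      9 v * w ^ 2 - 2 * D 7 v * D 8 v * w ^ 2) * hw
  · linear_combination (-D 8 v ^ 2 * w ^ 3 + 2 * D 6 v * D 10 v * w ^ 3 - 2 * D 9 v * D 7 v * w
      ^ 3 - 4 * D 12 v * D 4 v * w ^ 3) * hw
  · linear_combination (2 * D 5 v * D 12 v * w ^ 4 - 2 * D 9 v * D 8 v * w ^ 4 - 2 * D 10 v * D
      7 v * w ^ 4) * hw
  · linear_combination (-2 * D 9 v ^ 2 * w ^ 5 - 2 * D 10 v * D 8 v * w ^ 5 + 2 * D 6 v * D 12 v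
      * w ^ 5 - 2 * D 11 v * D 7 v * w ^ 5) * hw
  · linear_combination (-2 * D 12 v * D 7 v * w ^ 6 - 2 * D 8 v * D 11 v * w ^ 6) * hw
  · linear_combination (-2 * D 10 v ^ 2 * w ^ 7 - 2 * D 8 v * D 12 v * w ^ 7 - 2 * D 9 v * D 11
      v * w ^ 7) * hw
  · linear_combination (-2 * D 11 v * D 10 v * w ^ 8) * hw
  · linear_combination (-D 11 v ^ 2 * w ^ 9 - 4 * D 10 v * D 12 v * w ^ 9) * hw
  · linear_combination (-2 * D 12 v * D 11 v * w ^ 10) * hw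
  · linear_combination (-2 * D 12 v ^ 2 * w ^ 11) * hw
  · ring

theorem sum_pow_eq_zero {w : ℂ} (hw : w ^ 13 = 1) (hw1 : w ≠ 1) :
    ∑ k ∈ range 13, w ^ k = 0 := by
  have h := mul_geom_sum w 13
  rw [hw, sub_self] at h
  exact (mul_eq_zero.mp h).resolve_left (sub_ne_zero.mpr hw1)

theorem Dinf_oddFourier {w : ℂ} (hw : w ^ 13 = 1) (v : Fin 6 → ℂ) :
    Dinf (oddFourier w v) = D 0 (oddFourier (w ^ 8) v) := by
  have hpow : ∀ m n : ℕ, w ^ (13 * m + n) = w ^ n := fun m n => by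
    rw [pow_add, pow_mul, hw, one_pow, one_mul]
  have h2 : (w ^ 8) ^ 10 = w ^ 2 := by rw [← pow_mul]; exact hpow 6 2
  have h5 : (w ^ 8) ^ 12 = w ^ 5 := by rw [← pow_mul]; exact hpow 7 5
  have h11 : (w ^ 8) ^ 3 = w ^ 11 := by rw [← pow_mul]; exact hpow 1 11
  have h6 : (w ^ 8) ^ 4 = w ^ 6 := by rw [← pow_mul]; exact hpow 2 6
  have h7 : (w ^ 8) ^ 9 = w ^ 7 := by rw [← pow_mul]; exact hpow 5 7
  have h1 : (w ^ 8) ^ 5 = w := by rw [← pow_mul]; simpa using hpow 3 1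
  have h12 : (w ^ 8) ^ 8 = w ^ 12 := by rw [← pow_mul]; exact hpow 4 12
  have h3 : (w ^ 8) ^ 2 = w ^ 3 := by rw [← pow_mul]; exact hpow 1 3
  have h10 : (w ^ 8) ^ 11 = w ^ 10 := by rw [← pow_mul]; exact hpow 6 10
  have h9 : (w ^ 8) ^ 6 = w ^ 9 := by rw [← pow_mul]; exact hpow 3 9
  have h4 : (w ^ 8) ^ 7 = w ^ 4 := by rw [← pow_mul]; exact hpow 4 4
  simp only [D, Dinf, oddFourier, Matrix.cons_val, h1, h2, h3, h4, h5, h6, h7, h9, h10, h11, h12]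

theorem periodDiff_pow_eight {w : ℂ} (hw : w ^ 13 = 1) :
    periodDiff (w ^ 8) = -periodDiff' w := by
  have hpow : ∀ m n : ℕ, w ^ (13 * m + n) = w ^ n := fun m n => by
    rw [pow_add, pow_mul, hw, one_pow, one_mul]
  simp only [periodDiff, periodDiff', ← pow_mul]
  linear_combination hpow 1 11 + hpow 5 7 - hpow 2 6 - hpow 6 2 - hpow 7 5

theorem periodDiff'_pow_eight {w : ℂ} (hw : w ^ 13 = 1) :
    periodDiff' (w ^ 8) = periodDiff w := by
  have hpow : ∀ m n : ℕ, w ^ (13 * m + n) = w ^ n := fun m n => by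
    rw [pow_add, pow_mul, hw, one_pow, one_mul]
  simp only [periodDiff, periodDiff', ← pow_mul]
  linear_combination hpow 1 3 + hpow 3 1 + hpow 3 9 - hpow 4 4 - hpow 4 12 - hpow 6 10

/-- The invariance of `G₀` up to the forms `G_j` under the finite Fourier transform. -/
theorem Gs_zero_oddFourier {w : ℂ} (hw : w ^ 13 = 1) (hw1 : w ≠ 1) (v : Fin 6 → ℂ) :
    Gs 0 (oddFourier w v) = 13 * (-13 * Gs 0 v + ∑ j ∈ Icc 1 12, Gs j v) := by
  have hsum := sum_pow_eq_zero hw hw1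
  have hw8 : (w ^ 8) ^ 13 = 1 := by rw [pow_right_comm, hw, one_pow]
  have hw81 : w ^ 8 ≠ 1 := fun h => hw1 <| by
    have : w = (w ^ 8) ^ 5 / (w ^ 13) ^ 3 := by
      have : w ≠ 0 := by rintro rfl; norm_num at hw
      field_simp
    rw [this, h, hw]; norm_num
  have key : Gs 0 (oddFourier w v) =
      (periodDiff w ^ 2 + periodDiff' w ^ 2) * (13 * Gs 0 v - ∑ j ∈ Icc 1 12, Gs j v) := by
    rw [show Icc 1 12 = {1, 2, 3, 4, 5, 6, 7, 8, 9, 10, 11, 12} from rfl]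
    simp only [sum_insert, mem_insert, mem_singleton, sum_singleton, Nat.reduceEqDiff, or_self,
      not_false_eq_true, Gs]
    rw [Dinf_oddFourier hw, D_zero_oddFourier hsum, D_zero_oddFourier (sum_pow_eq_zero hw8 hw81),
      periodDiff_pow_eight hw, periodDiff'_pow_eight hw]
    ring
  rw [key, periodDiff_sq_add hsum]
  ring

/-- Representatives of the nonzero elements of `ℤ/13` modulo sign, ordered so that the
entries of `Smat` are differences of additive characters at products of nodes. -/
def node : Fin 6 → ZMod 13 := ![-1, -3, 4, 5, 2, 6]

/-- The finite Fourier transform of the odd function on `ℤ/13` with values `v` at the nodes. -/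
def oddTransform (ψ : AddChar (ZMod 13) ℂ) (v : Fin 6 → ℂ) (x : ZMod 13) : ℂ :=
  ∑ l, (ψ (-(x * node l)) - ψ (x * node l)) * v l

theorem addChar_pow (ψ : AddChar (ZMod 13) ℂ) (b : ZMod 13) (n : ℕ) : ψ b ^ n = ψ (n * b) := by
  rw [← AddChar.map_nsmul_eq_pow, nsmul_eq_mul]

theorem oddFourier_apply (ψ : AddChar (ZMod 13) ℂ) (v : Fin 6 → ℂ) (i : Fin 6) :
    oddFourier (ψ 1) v i = oddTransform ψ v (node i) := by
  simp only [oddTransform, Fin.sum_univ_six, oddFourier, addChar_pow]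
  fin_cases i <;> rfl

theorem twist_apply (ψ : AddChar (ZMod 13) ℂ) (b : ZMod 13) (v : Fin 6 → ℂ) (i : Fin 6) :
    twist (ψ b) v i = ψ (7 * b * node i ^ 2) * v i := by
  simp only [twist, addChar_pow]
  fin_cases i <;> simp [node] <;> left <;> congr 1 <;> revert b <;> decide

theorem sum_eq_sum_node (F : ZMod 13 → ℂ) :
    ∑ y, F y = F 0 + ∑ i, (F (node i) + F (-node i)) := by
  rw [show (univ : Finset (ZMod 13)) = {0, -1, 1, -3, 3, 4, -4, 5, -5, 2, -2, 6, -6} by decide]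
  repeat rw [sum_insert (by decide)]
  simp [Fin.sum_univ_six, node]
  ring

theorem addChar_pow_thirteen (ψ : AddChar (ZMod 13) ℂ) (b : ZMod 13) : ψ b ^ 13 = 1 := by
  rw [addChar_pow, show ((13 : ℕ) : ZMod 13) = 0 from rfl, zero_mul, AddChar.map_zero_eq_one]

theorem addChar_ne_one {ψ : AddChar (ZMod 13) ℂ} (hψ : ψ 1 ≠ 1) {b c : ZMod 13} (hbc : b * c = 1) :
    ψ b ≠ 1 := fun h => hψ <| by
  have := addChar_pow ψ b c.val
  rwa [h, one_pow, ZMod.natCast_zmod_val, mul_comm, hbc, eq_comm] at this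

/-- The quadratic Gauss sum of `x ↦ b x² / 2` on `ℤ/13`. -/
def quadGauss (ψ : AddChar (ZMod 13) ℂ) (b : ZMod 13) : ℂ := ∑ y, ψ (7 * b * y ^ 2)

theorem quadGauss_sq {ψ : AddChar (ZMod 13) ℂ} (hψ : ψ 1 ≠ 1) {b c : ZMod 13} (hbc : b * c = 1) :
    quadGauss ψ b ^ 2 = 13 := by
  have hw := sum_pow_eq_zero (addChar_pow_thirteen ψ b) (addChar_ne_one hψ hbc)
  have hG : quadGauss ψ b = 1 + 2 * (ψ b ^ 7 + ψ b ^ 11 + ψ b ^ 8 + ψ b ^ 6 + ψ b ^ 2 + ψ b ^ 5) := by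
    have h (i : Fin 6) : ψ (7 * b * node i ^ 2) = twist (ψ b) 1 i := by simp [twist_apply]
    simp only [quadGauss, sum_eq_sum_node, neg_sq, h, Fin.sum_univ_six, twist, Pi.one_apply,
      mul_one, Matrix.cons_val]
    simp
    ring
  simp only [sum_range_succ, sum_range_zero] at hw
  rw [hG]
  generalize ψ b = w at hw
  linear_combination (- 12 + 12 * w + 4 * w ^ 2 - 4 * w ^ 3 + 4 * w ^ 4 + 8 * w ^ 7
    - 4 * w ^ 9 + 4 * w ^ 10) * hw

theorem sum_addChar_quadratic (ψ : AddChar (ZMod 13) ℂ) {b c : ZMod 13} (hbc : b * c = 1)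
    (x : ZMod 13) :
    ∑ y, ψ (7 * b * y ^ 2 - y * x) = quadGauss ψ b * ψ (-(7 * c * x ^ 2)) := by
  rw [quadGauss, sum_mul, ← Equiv.sum_comp (Equiv.addRight (c * x))]
  refine sum_congr rfl fun y _ => ?_
  rw [← AddChar.map_add_eq_mul]
  congr 1
  have h13 : (13 : ZMod 13) = 0 := rfl
  simp only [Equiv.coe_addRight]
  linear_combination (14 * x * y + 7 * c * x ^ 2) * hbc + (x * y + c * x ^ 2) * h13

theorem oddFourier_twist_oddFourier (ψ : AddChar (ZMod 13) ℂ) {b c : ZMod 13} (hbc : b * c = 1)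
    (v : Fin 6 → ℂ) (i : Fin 6) :
    oddFourier (ψ 1) (twist (ψ b) (oddFourier (ψ 1) v)) i =
      quadGauss ψ b * ψ (-(7 * c * node i ^ 2)) *
        oddTransform ψ (twist (ψ (-c)) v) (c * node i) := by
  have h14 : (13 : ZMod 13) = 0 := rfl
  have inner (x z : ZMod 13) :
      ∑ j, (ψ (-(x * node j)) - ψ (x * node j)) *
        (ψ (7 * b * node j ^ 2) * (ψ (-(node j * z)) - ψ (node j * z))) =
      quadGauss ψ b * (ψ (-(7 * c * (x + z) ^ 2)) - ψ (-(7 * c * (x - z) ^ 2))) := by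
    rw [mul_sub, ← sum_addChar_quadratic ψ hbc, ← sum_addChar_quadratic ψ hbc, ← sum_sub_distrib,
      sum_eq_sum_node]
    simp only [zero_mul, sub_self, zero_add]
    refine sum_congr rfl fun j _ => ?_
    simp only [sub_mul, mul_sub, ← AddChar.map_add_eq_mul]
    ring_nf
  simp only [oddFourier_apply, oddTransform, twist_apply]
  simp_rw [mul_sum]
  rw [sum_comm]
  refine sum_congr rfl fun l _ => ?_
  have := inner (node i) (node l)
  calc _ = (∑ j, (ψ (-(node i * node j)) - ψ (node i * node j)) *
        (ψ (7 * b * node j ^ 2) * (ψ (-(node j * node l)) - ψ (node j * node l)))) * v l := by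
        rw [sum_mul]
        exact sum_congr rfl fun j _ => by ring
    _ = quadGauss ψ b * ((ψ (-(7 * c * node i ^ 2)) * (ψ (-(c * node i * node l)) -
        ψ (c * node i * node l)) * ψ (7 * -c * node l ^ 2))) * v l := by
        rw [inner]
        simp only [mul_sub, sub_mul, ← AddChar.map_add_eq_mul]
        congr 5
        · linear_combination (-c * node i * node l) * h14
        · linear_combination (c * node i * node l) * h14
    _ = _ := by ring

theorem oddTransform_neg (ψ : AddChar (ZMod 13) ℂ) (v : Fin 6 → ℂ) (x : ZMod 13) :
    oddTransform ψ v (-x) = -oddTransform ψ v x := by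
  simp only [oddTransform, neg_mul, neg_neg, ← sum_neg_distrib]
  exact sum_congr rfl fun l _ => by ring

theorem Gs_zero_oddTransform_mul (ψ : AddChar (ZMod 13) ℂ) (v : Fin 6 → ℂ) {b c : ZMod 13}
    (hbc : b * c = 1) :
    Gs 0 (fun i => oddTransform ψ v (c * node i)) = Gs 0 (fun i => oddTransform ψ v (node i)) := by
  have h (a b : ZMod 13) (hab : b = -a) : oddTransform ψ v b = -oddTransform ψ v a := by
    rw [hab, oddTransform_neg]
  simp only [Gs, D, Dinf, node, Matrix.cons_val]
  generalize oddTransform ψ v = N at h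
  have h12 := h 1 12 rfl
  have h11 := h 2 11 rfl
  have h10 := h 3 10 rfl
  have h9 := h 4 9 rfl
  have h8 := h 5 8 rfl
  have h7 := h 6 7 rfl
  have hc : c ≠ 0 := by rintro rfl; rw [mul_zero] at hbc; exact absurd hbc (by decide)
  clear hbc h
  obtain ⟨k, hk, rfl⟩ : ∃ k : ℕ, k < 13 ∧ (k : ZMod 13) = c :=
    ⟨c.val, c.val_lt, ZMod.natCast_zmod_val c⟩
  have hk0 : 0 < k := Nat.pos_of_ne_zero <| by rintro rfl; exact hc Nat.cast_zero
  clear hc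
  interval_cases k
  · simp
  all_goals
    push_cast
    reduce_mod_char
    simp only [h7, h8, h9, h10, h11, h12]
    ring

theorem Gs_zero_oddFourier_twist_oddFourier {ψ : AddChar (ZMod 13) ℂ} (hψ : ψ 1 ≠ 1)
    {b c : ZMod 13} (hbc : b * c = 1) (v : Fin 6 → ℂ) :
    Gs 0 (oddFourier (ψ 1) (twist (ψ b) (oddFourier (ψ 1) v))) =
      13 ^ 3 * Gs 0 (oddFourier (ψ 1) (twist (ψ (-c)) v)) := by
  have hG : quadGauss ψ b ^ 6 = 13 ^ 3 := by
    rw [← quadGauss_sq hψ hbc]; ring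
  have hR : oddFourier (ψ 1) (twist (ψ (-c)) v) =
      fun i => oddTransform ψ (twist (ψ (-c)) v) (node i) :=
    funext fun i => oddFourier_apply ψ _ i
  have hprod (x y z : ZMod 13) (h : x + y + z = 0) : ψ x * ψ y * ψ z = 1 := by
    rw [← AddChar.map_add_eq_mul, ← AddChar.map_add_eq_mul, h, AddChar.map_zero_eq_one]
  have h1 := hprod (-(7 * c * node 0 ^ 2)) (-(7 * c * node 1 ^ 2)) (-(7 * c * node 2 ^ 2))
    (by clear hR hbc; revert c; decide)
  have h2 := hprod (-(7 * c * node 3 ^ 2)) (-(7 * c * node 4 ^ 2)) (-(7 * c * node 5 ^ 2))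
    (by clear hR hbc h1; revert c; decide)
  rw [hR, ← Gs_zero_oddTransform_mul ψ _ hbc, ← hG]
  simp only [Gs, D, Dinf, oddFourier_twist_oddFourier ψ hbc]
  generalize oddTransform ψ _ (c * node 0) = n0
  generalize oddTransform ψ _ (c * node 1) = n1
  generalize oddTransform ψ _ (c * node 2) = n2
  generalize oddTransform ψ _ (c * node 3) = n3
  generalize oddTransform ψ _ (c * node 4) = n4
  generalize oddTransform ψ _ (c * node 5) = n5
  generalize ψ (-(7 * c * node 0 ^ 2)) = e0 at h1
  generalize ψ (-(7 * c * node 1 ^ 2)) = e1 at h1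
  generalize ψ (-(7 * c * node 2 ^ 2)) = e2 at h1
  generalize ψ (-(7 * c * node 3 ^ 2)) = e3 at h2
  generalize ψ (-(7 * c * node 4 ^ 2)) = e4 at h2
  generalize ψ (-(7 * c * node 5 ^ 2)) = e5 at h2
  calc _ = quadGauss ψ b ^ 6 * ((e0 * e1 * e2) ^ 2 * (n0 * n1 * n2) ^ 2 +
        (e3 * e4 * e5) ^ 2 * (n3 * n4 * n5) ^ 2) := by ring
    _ = _ := by rw [h1, h2]; ring

theorem oddFourier_oddFourier {ψ : AddChar (ZMod 13) ℂ} (hψ : ψ 1 ≠ 1) (v : Fin 6 → ℂ) :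
    oddFourier (ψ 1) (oddFourier (ψ 1) v) = fun i => -13 * v i := by
  have hsum (x : ZMod 13) : ∑ y, ψ (y * x) = if x = 0 then 13 else 0 := by
    split_ifs with hx
    · simp [hx]
    · obtain ⟨y, hy⟩ : ∃ y, x * y = 1 := by revert x; decide
      rw [← sum_pow_eq_zero (addChar_pow_thirteen ψ x) (addChar_ne_one hψ hy), sum_range]
      exact sum_congr rfl fun y _ => by
        rw [addChar_pow]
        exact congrArg _ (congrArg (· * x) (ZMod.natCast_zmod_val (n := 13) y).symm)
  have inner (x z : ZMod 13) :
      ∑ j, (ψ (-(x * node j)) - ψ (x * node j)) * (ψ (-(node j * z)) - ψ (node j * z)) =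
      (if x + z = 0 then 13 else 0) - (if x - z = 0 then 13 else 0) := by
    rw [← hsum, ← hsum, ← sum_sub_distrib, sum_eq_sum_node]
    simp only [zero_mul, sub_self, zero_add]
    refine sum_congr rfl fun j _ => ?_
    simp only [sub_mul, mul_sub, ← AddChar.map_add_eq_mul]
    ring_nf
  funext i
  simp only [oddFourier_apply, oddTransform]
  simp_rw [mul_sum]
  rw [sum_comm]
  have h1 (i l : Fin 6) : node i + node l ≠ 0 := by revert i l; decide
  have h2 (i l : Fin 6) : node i - node l = 0 ↔ l = i := by revert i l; decide
  calc _ = ∑ l, (∑ j, (ψ (-(node i * node j)) - ψ (node i * node j)) *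
        (ψ (-(node j * node l)) - ψ (node j * node l))) * v l := by
        refine sum_congr rfl fun l _ => ?_
        rw [sum_mul]
        exact sum_congr rfl fun j _ => by ring
    _ = _ := by simp [inner, h1, h2, ite_mul]

/-- The additive character `n ↦ ζ ^ n` of `ℤ/13`. -/
def zetaChar : AddChar (ZMod 13) ℂ := ZMod.stdAddChar

theorem zetaChar_intCast (n : ℤ) : zetaChar n = exp (n * (2 * Real.pi * I / 13)) := by
  rw [zetaChar, ZMod.stdAddChar_coe]
  congr 1
  push_cast
  ring

theorem zetaChar_natCast (n : ℕ) : zetaChar n = ζ ^ n := by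
  have := zetaChar_intCast n
  rw [zeta13, ← exp_nat_mul]
  simpa only [Int.cast_natCast] using this

theorem zetaChar_one : zetaChar 1 = ζ := by simpa using zetaChar_natCast 1

theorem zeta13_pow : ζ ^ 13 = 1 := by
  rw [← zetaChar_one, addChar_pow_thirteen]

theorem zetaChar_one_ne_one : zetaChar 1 ≠ 1 := fun h =>
  absurd (ZMod.injective_stdAddChar (N := 13) (h.trans (AddChar.map_zero_eq_one _).symm)) (by decide)

theorem zeta13_ne_one : ζ ≠ 1 := zetaChar_one ▸ zetaChar_one_ne_one

/-- The form `δ_ν`, with `ν` taken modulo 13. -/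
def deltaChar (b : ZMod 13) (v : Fin 6 → ℂ) : ℂ :=
  -13 * Gs 0 v + ∑ j ∈ Icc 1 12, zetaChar b ^ j * Gs j v

theorem sum_deltaF_sq (v : Fin 6 → ℂ) :
    ∑ ν ∈ range 13, deltaF ν v ^ 2 = ∑ b, deltaChar b v ^ 2 := by
  have h (ν : ℕ) : deltaF ν v = deltaChar (ν : ZMod 13) v := by
    simp only [deltaF, deltaChar, zetaChar_natCast, ← pow_mul, mul_comm]
  rw [sum_range]
  exact sum_congr rfl fun i _ => by
    rw [h]
    exact congrArg (deltaChar · v ^ 2) (ZMod.natCast_zmod_val (n := 13) i)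

theorem deltaChar_twist (b c : ZMod 13) (v : Fin 6 → ℂ) :
    deltaChar b (twist (zetaChar c) v) = deltaChar (b + c) v := by
  have hc := addChar_pow_thirteen zetaChar c
  rw [deltaChar, deltaChar, Gs_twist hc v (by norm_num), pow_zero, one_mul]
  congr 1
  refine sum_congr rfl fun j hj => ?_
  rw [Gs_twist hc v (by grind), AddChar.map_add_eq_mul, mul_pow, mul_assoc]

theorem Gs_zero_oddFourier_twist (b : ZMod 13) (v : Fin 6 → ℂ) :
    Gs 0 (oddFourier ζ (twist (zetaChar b) v)) = 13 * deltaChar b v := by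
  rw [Gs_zero_oddFourier zeta13_pow zeta13_ne_one, ← zero_add b, ← deltaChar_twist]
  simp [deltaChar]

theorem twist_one (v : Fin 6 → ℂ) : twist 1 v = v := by
  funext i
  fin_cases i <;> simp [twist]

theorem deltaChar_zero_oddFourier (v : Fin 6 → ℂ) :
    deltaChar 0 (oddFourier ζ v) = 13 ^ 3 * deltaInf v := by
  have h := Gs_zero_oddFourier_twist 0 (oddFourier ζ v)
  rw [AddChar.map_zero_eq_one, twist_one, ← zetaChar_one,
    oddFourier_oddFourier zetaChar_one_ne_one] at h
  rw [← zetaChar_one]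
  refine mul_left_cancel₀ (by norm_num : (13 : ℂ) ≠ 0) (h.symm.trans ?_)
  simp only [deltaInf, Gs, D, Dinf]
  ring

theorem deltaInf_oddFourier (v : Fin 6 → ℂ) :
    deltaInf (oddFourier ζ v) = 13 ^ 3 * deltaChar 0 v := by
  have h := Gs_zero_oddFourier_twist 0 v
  rw [AddChar.map_zero_eq_one, twist_one] at h
  rw [deltaInf, h]
  ring

theorem deltaChar_oddFourier {b c : ZMod 13} (hbc : b * c = 1) (v : Fin 6 → ℂ) :
    deltaChar b (oddFourier ζ v) = 13 ^ 3 * deltaChar (-c) v := by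
  have h := Gs_zero_oddFourier_twist_oddFourier zetaChar_one_ne_one hbc v
  rw [zetaChar_one, Gs_zero_oddFourier_twist, Gs_zero_oddFourier_twist] at h
  exact mul_left_cancel₀ (by norm_num : (13 : ℂ) ≠ 0) (h.trans (by ring))

theorem Phi12_oddFourier (v : Fin 6 → ℂ) : Phi12 (oddFourier ζ v) = 13 ^ 6 * Phi12 v := by
  have : Fact (Nat.Prime 13) := ⟨by norm_num⟩
  have h (b : ZMod 13) : deltaChar b (oddFourier ζ v) ^ 2 = 13 ^ 6 * (deltaChar (-b⁻¹) v ^ 2 +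
      if b = 0 then deltaInf v ^ 2 - deltaChar 0 v ^ 2 else 0) := by
    split_ifs with hb
    · rw [hb, deltaChar_zero_oddFourier, inv_zero, neg_zero]
      ring
    · rw [deltaChar_oddFourier (mul_inv_cancel₀ hb)]
      ring
  have hperm : ∑ b : ZMod 13, deltaChar (-b⁻¹) v ^ 2 = ∑ b, deltaChar b v ^ 2 :=
    ((Equiv.inv (ZMod 13)).trans (Equiv.neg _)).sum_comp fun b => deltaChar b v ^ 2
  simp only [Phi12, sum_deltaF_sq, h, deltaInf_oddFourier, ← mul_sum, sum_add_distrib, hperm,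
    sum_ite_eq', mem_univ, if_true]
  ring

theorem Phi12_twist (v : Fin 6 → ℂ) : Phi12 (twist ζ v) = Phi12 v := by
  simp only [Phi12, sum_deltaF_sq, deltaInf, Gs_twist zeta13_pow v (show 0 < 13 by norm_num)]
  simp only [← zetaChar_one, deltaChar_twist, pow_zero, one_mul]
  rw [← Equiv.sum_comp (Equiv.addRight (1 : ZMod 13)) (fun b => deltaChar b v ^ 2)]
  rfl

theorem Phi12_smul (r : ℂ) (v : Fin 6 → ℂ) : Phi12 (fun i => r * v i) = r ^ 12 * Phi12 v := by
  have hD {j : ℕ} (hj : j < 13) : D j (fun i => r * v i) = r ^ 3 * D j v := by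
    interval_cases j <;> simp only [D] <;> ring
  have hDinf : Dinf (fun i => r * v i) = r ^ 3 * Dinf v := by simp only [Dinf]; ring
  have hG {j : ℕ} (hj : j < 13) : Gs j (fun i => r * v i) = r ^ 6 * Gs j v := by
    interval_cases j <;> simp (disch := norm_num only) only [Gs, hD, hDinf] <;> ring
  have hδ (b : ZMod 13) : deltaChar b (fun i => r * v i) = r ^ 6 * deltaChar b v := by
    rw [deltaChar, deltaChar, hG (by norm_num), mul_add, mul_sum]
    congr 1
    · ring
    · refine sum_congr rfl fun j hj => ?_
      rw [hG (by grind)]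
      ring
  simp only [Phi12, sum_deltaF_sq, deltaInf, hδ, hG (show 0 < 13 by norm_num), mul_pow, ← mul_sum]
  ring

/-- The `m`-th term `(-1) ^ m q ^ ((m - 13 / 2) ^ 2 / 26)` of the theta series of order 13. -/
def thetaTerm (m : ℤ) (z : ℂ) : ℂ :=
  exp (Real.pi * I * m + Real.pi * I * z / 13 * (m - 13 / 2) ^ 2)

/-- The part of the theta series of order 13 supported on a residue class modulo 13. -/
def thetaRes (x : ZMod 13) (z : ℂ) : ℂ := ∑' n : ℤ, thetaTerm (13 * n + x.val) z

theorem thetaRes_intCast (k : ℤ) (z : ℂ) :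
    thetaRes k z = ∑' n : ℤ, thetaTerm (13 * n + k) z := by
  rw [thetaRes, ← (Equiv.addRight (k / 13)).tsum_eq]
  refine tsum_congr fun n => ?_
  rw [Equiv.coe_addRight, ZMod.val_intCast]
  congr 1
  push_cast
  lia

theorem thetaTerm_thirteen_sub (m : ℤ) (z : ℂ) : thetaTerm (13 - m) z = -thetaTerm m z := by
  rw [thetaTerm, thetaTerm, ← exp_add_pi_mul_I, exp_eq_exp_iff_exists_int]
  refine ⟨6 - m, ?_⟩
  push_cast
  ring

theorem thetaRes_neg (x : ZMod 13) (z : ℂ) : thetaRes (-x) z = -thetaRes x z := by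
  obtain ⟨k, rfl⟩ := ZMod.intCast_surjective x
  rw [← Int.cast_neg, thetaRes_intCast, thetaRes_intCast, ← tsum_neg, ← (Equiv.subLeft 1).tsum_eq]
  refine tsum_congr fun n => ?_
  rw [← thetaTerm_thirteen_sub, Equiv.subLeft_apply]
  congr 1
  ring

theorem qp_mul_thetaSum (c k : ℤ) (hk : 2 * k = 13 + c) (z : ℂ) :
    qp (c ^ 2 / 104) z * thetaSum c z = (-1) ^ k * thetaRes k z := by
  rw [thetaRes_intCast, thetaSum, ← tsum_mul_left, ← tsum_mul_left]
  refine tsum_congr fun n => ?_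
  obtain rfl : c = 2 * k - 13 := by lia
  have h (j : ℤ) : (-1 : ℂ) ^ j = exp (j * (Real.pi * I)) := by rw [exp_int_mul, exp_pi_mul_I]
  rw [qp, qp, thetaTerm, h, h, ← exp_add, ← exp_add, ← exp_add, exp_eq_exp_iff_exists_int]
  refine ⟨-(k + 6 * n), ?_⟩
  push_cast
  ring

theorem Avec_eq_thetaRes (z : ℂ) : Avec z = fun i => thetaRes (node i) z := by
  have h12 := qp_mul_thetaSum 11 12 rfl z
  have h10 := qp_mul_thetaSum 7 10 rfl z
  have h9 := qp_mul_thetaSum 5 9 rfl z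
  have h8 := qp_mul_thetaSum 3 8 rfl z
  have h11 := qp_mul_thetaSum 9 11 rfl z
  have h7 := qp_mul_thetaSum 1 7 rfl z
  rw [show ((9 : ℤ) : ZMod 13) = -4 from rfl, thetaRes_neg] at h9
  rw [show ((8 : ℤ) : ZMod 13) = -5 from rfl, thetaRes_neg] at h8
  rw [show ((11 : ℤ) : ZMod 13) = -2 from rfl, thetaRes_neg] at h11
  rw [show ((7 : ℤ) : ZMod 13) = -6 from rfl, thetaRes_neg] at h7
  rw [show ((12 : ℤ) : ZMod 13) = -1 from rfl] at h12
  rw [show ((10 : ℤ) : ZMod 13) = -3 from rfl] at h10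
  norm_num [-one_div] at h7 h8 h9 h10 h11 h12
  funext i
  fin_cases i <;> simp [Avec, thc, node, -one_div, *]

theorem thetaRes_add_one (x : ZMod 13) (z : ℂ) :
    thetaRes x (z + 1) = exp (13 * Real.pi * I / 4) * zetaChar (7 * x ^ 2) * thetaRes x z := by
  obtain ⟨k, rfl⟩ := ZMod.natCast_zmod_surjective x
  have hc : zetaChar (7 * (k : ZMod 13) ^ 2) = exp (7 * k ^ 2 * (2 * Real.pi * I / 13)) := by
    have := zetaChar_natCast (7 * k ^ 2)
    push_cast at this
    rw [this, zeta13, ← exp_nat_mul]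
    push_cast
    ring_nf
  have hx : (k : ZMod 13) = ((k : ℤ) : ZMod 13) := by simp
  rw [hc, hx, thetaRes_intCast, thetaRes_intCast, ← tsum_mul_left]
  refine tsum_congr fun n => ?_
  obtain ⟨l, hl⟩ : (2 : ℤ) ∣ 13 * (n ^ 2 - n) + (2 * n * k - k - k ^ 2) := by
    obtain ⟨a, ha⟩ := Int.even_mul_pred_self n
    obtain ⟨b, hb⟩ := Int.even_mul_succ_self k
    exact ⟨13 * a + n * k - b, by linear_combination 13 * ha - hb⟩
  rw [thetaTerm, thetaTerm, ← exp_add, ← exp_add, exp_eq_exp_iff_exists_int]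
  refine ⟨l, ?_⟩
  have := congrArg (Int.cast : ℤ → ℂ) hl
  push_cast at this ⊢
  linear_combination (Real.pi * I) * this

theorem summable_thetaTerm_char (k : ℤ) {z : ℂ} (hz : 0 < z.im) :
    Summable fun m : ℤ => zetaChar (k * m) * thetaTerm m z := by
  have hτ : 0 < (z / 13).im := by
    rw [show z / 13 = z / (13 : ℝ) by simp, div_ofReal_im]
    positivity
  refine ((hasSum_jacobiTheta₂_term (k / 13 + 1 / 2 - z / 2) hτ).summable.mul_left
    (exp (13 * Real.pi * I * z / 4))).congr fun m => ?_
  rw [← Int.cast_mul, zetaChar_intCast, thetaTerm, jacobiTheta₂_term, ← exp_add, ← exp_add]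
  push_cast
  ring_nf

theorem tsum_thetaTerm_char (k : ℤ) {z : ℂ} (hz : 0 < z.im) :
    ∑' m : ℤ, zetaChar (k * m) * thetaTerm m z = ∑ y, zetaChar (k * y) * thetaRes y z := by
  let e : ZMod 13 × ℤ ≃ ℤ := (Equiv.prodComm _ _).trans (Int.divModEquiv 13).symm
  have he (y : ZMod 13) (n : ℤ) : e (y, n) = 13 * n + y.val := by
    have h := Int.divModEquiv_symm_apply (n := 13) (n, y)
    exact h.trans (by rw [mul_comm]; rfl)
  have hs := e.summable_iff.mpr (summable_thetaTerm_char k hz)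
  rw [← e.tsum_eq]
  refine hs.tsum_prod.trans ?_
  rw [tsum_fintype]
  refine sum_congr rfl fun y _ => ?_
  rw [thetaRes, ← tsum_mul_left]
  refine tsum_congr fun n => ?_
  rw [Function.comp_apply, he]
  congr 3
  have h13 : (13 : ZMod 13) = 0 := rfl
  simp [h13]

theorem thetaRes_neg_one_div (x : ZMod 13) {z : ℂ} (hz : 0 < z.im) :
    thetaRes x (-1 / z) =
      I * (1 / (-I * (13 * (-1 / z))) ^ (1 / 2 : ℂ)) * ∑ y, zetaChar (x * y) * thetaRes y z := by
  obtain ⟨k, rfl⟩ := ZMod.intCast_surjective x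
  have hz0 : z ≠ 0 := by rintro rfl; simp at hz
  set τ := 13 * (-1 / z) with hτ
  have hτ0 : τ ≠ 0 := by simp [hτ, hz0]
  set s : ℂ := k / 13 - 1 / 2 with hs
  have hl : thetaRes k (-1 / z) = exp (Real.pi * I * k + Real.pi * I * τ * s ^ 2) *
      jacobiTheta₂ (1 / 2 + τ * s) τ := by
    rw [thetaRes_intCast, jacobiTheta₂, ← tsum_mul_left]
    refine tsum_congr fun n => ?_
    rw [thetaTerm, jacobiTheta₂_term, ← exp_add, exp_eq_exp_iff_exists_int]
    refine ⟨6 * n, ?_⟩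
    rw [hτ, hs]
    push_cast
    ring
  have hr : ∑ y, zetaChar (k * y) * thetaRes y z =
      exp (12 * Real.pi * I * k / 13 + Real.pi * I * z / 52) *
        jacobiTheta₂ ((1 / 2 + τ * s) / τ) (-1 / τ) := by
    rw [← tsum_thetaTerm_char k hz, jacobiTheta₂, ← tsum_mul_left, ← (Equiv.addRight 6).tsum_eq]
    refine tsum_congr fun m => ?_
    rw [Equiv.coe_addRight, ← Int.cast_mul, zetaChar_intCast, thetaTerm, jacobiTheta₂_term,
      ← exp_add, ← exp_add, exp_eq_exp_iff_exists_int]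
    refine ⟨m + 3, ?_⟩
    have h1 : (1 / 2 + τ * s) / τ = s - z / 26 := by rw [hτ]; field_simp; ring
    have h2 : -1 / τ = z / 13 := by rw [hτ]; field_simp
    rw [h1, h2, hs]
    push_cast
    ring
  have hI : I = exp (Real.pi / 2 * I) := exp_pi_div_two_mul_I.symm
  rw [hl, hr, jacobiTheta₂_functional_equation]
  have key : exp (Real.pi * I * k + Real.pi * I * τ * s ^ 2) *
      exp (-Real.pi * I * (1 / 2 + τ * s) ^ 2 / τ) =
      I * exp (12 * Real.pi * I * k / 13 + Real.pi * I * z / 52) := by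
    refine (exp_add _ _).symm.trans (.trans ?_ (congrArg (· * _) hI.symm))
    rw [← exp_add]
    congr 1
    rw [hs, hτ]
    field_simp
    ring
  linear_combination (1 / (-I * τ) ^ (1 / 2 : ℂ) *
    jacobiTheta₂ ((1 / 2 + τ * s) / τ) (-1 / τ)) * key

theorem etaF_eq_eta : etaF = ModularForm.eta := by
  funext z
  simp only [etaF, ModularForm.eta, ModularForm.eta_q_eq_pow, qp, Function.Periodic.qParam]
  congr 2
  push_cast
  ring

theorem etaF_add_one (z : ℂ) : etaF (z + 1) = exp (Real.pi * I / 12) * etaF z := by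
  have h : exp (2 * Real.pi * I * (z + 1)) = exp (2 * Real.pi * I * z) := by
    rw [mul_add, mul_one, exp_add, exp_two_pi_mul_I, mul_one]
  rw [etaF, etaF, h, qp, qp, ← mul_assoc, ← exp_add]
  congr 2
  push_cast
  ring

theorem etaF_neg_one_div_pow {z : ℂ} (hz : 0 < z.im) :
    etaF (-1 / z) ^ 12 = -(z ^ 6 * etaF z ^ 12) := by
  have hz0 : z ≠ 0 := by rintro rfl; simp at hz
  have hsqrt {w : ℂ} (hw : w ≠ 0) : sqrt w ^ 12 = w ^ 6 := by
    rw [sqrt_eq_exp hw, ← exp_nat_mul, ← exp_log hw, ← exp_nat_mul, exp_log hw]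
    push_cast
    ring_nf
  have h : etaF (-1 / z) = (sqrt I)⁻¹ * (sqrt z * etaF z) := by
    rw [etaF_eq_eta]
    exact ModularForm.eta_comp_eq_csqrt_I_inv hz
  have hI : I ^ 6 = -1 := by rw [show 6 = 2 * 3 from rfl, pow_mul, I_sq]; norm_num
  rw [h, mul_pow, mul_pow, inv_pow, hsqrt I_ne_zero, hsqrt hz0, hI]
  ring

theorem X_add_one (z : ℂ) :
    X (z + 1) = fun i => exp (10 * Real.pi * I / 3) * twist ζ (X z) i := by
  funext i
  have h := twist_apply zetaChar 1
  simp only [zetaChar_one] at h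
  have hA := congrFun (Avec_eq_thetaRes (z + 1)) i
  have hA' := congrFun (Avec_eq_thetaRes z) i
  simp only [Avec] at hA hA'
  rw [h, X, X, hA, hA', thetaRes_add_one, etaF_add_one, mul_one,
    show 10 * (Real.pi : ℂ) * I / 3 = 13 * Real.pi * I / 4 + Real.pi * I / 12 by ring, exp_add]
  ring

theorem X_neg_one_div {z : ℂ} (hz : 0 < z.im) : ∃ r : ℂ, r ^ 12 = z ^ 12 / 13 ^ 6 ∧
    X (-1 / z) = fun i => r * oddFourier ζ (X z) i := by
  have hz0 : z ≠ 0 := by rintro rfl; simp at hz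
  have hη : etaF z ≠ 0 := by rw [etaF_eq_eta]; exact ModularForm.eta_ne_zero hz
  set c := (-I * (13 * (-1 / z))) ^ (1 / 2 : ℂ) with hc
  have hc12 : c ^ 12 = (-I * (13 * (-1 / z))) ^ 6 := by
    rw [hc, ← cpow_nat_mul, ← cpow_natCast]
    norm_num
  have hI : I ^ 6 = -1 := by rw [show 6 = 2 * 3 from rfl, pow_mul, I_sq]; norm_num
  refine ⟨etaF (-1 / z) * (-(I * (1 / c))) / etaF z, ?_, ?_⟩
  · rw [div_pow, mul_pow, etaF_neg_one_div_pow hz, neg_pow, mul_pow, div_pow, hc12,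
      show -I * (13 * (-1 / z)) = I * (13 / z) by ring, mul_pow,
      show I ^ 12 = (I ^ 6) ^ 2 by ring, hI, div_pow]
    field_simp
  · have hψ := oddFourier_apply zetaChar
    rw [zetaChar_one] at hψ
    have hA := Avec_eq_thetaRes z
    have hA' := Avec_eq_thetaRes (-1 / z)
    have hX (w : ℂ) : X w = fun i => etaF w * Avec w i := rfl
    funext i
    simp only [hψ, hX, hA, hA', thetaRes_neg_one_div _ hz, sum_eq_sum_node, oddTransform,
      mul_zero, thetaRes_neg]
    have h0 : thetaRes 0 z = 0 := by
      have := thetaRes_neg 0 z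
      rw [neg_zero] at this
      linear_combination this / 2
    rw [← hc, h0, mul_zero, zero_add, mul_sum, mul_sum, mul_sum]
    refine sum_congr rfl fun l _ => ?_
    rw [mul_neg (node i) (node l)]
    field_simp
    ring

theorem Phi12_X_add_one (z : ℂ) : Phi12 (X (z + 1)) = Phi12 (X z) := by
  rw [X_add_one, Phi12_smul, Phi12_twist, ← exp_nat_mul,
    show ((12 : ℕ) : ℂ) * (10 * Real.pi * I / 3) = (20 : ℕ) * (2 * Real.pi * I) by push_cast; ring,
    exp_nat_mul_two_pi_mul_I, one_mul]

theorem Phi12_X_neg_one_div {z : ℂ} (hz : 0 < z.im) :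
    Phi12 (X (-1 / z)) = z ^ 12 * Phi12 (X z) := by
  obtain ⟨r, hr, hX⟩ := X_neg_one_div hz
  rw [hX, Phi12_smul, Phi12_oddFourier, hr]
  field_simp

open ModularForm in
theorem slash_Phi12_X (γ : Matrix.SpecialLinearGroup (Fin 2) ℤ) :
    (fun τ : UpperHalfPlane => Phi12 (X τ)) ∣[(12 : ℤ)] γ =
      fun τ : UpperHalfPlane => Phi12 (X τ) := by
  refine SlashInvariantForm.slash_action_generators_SL2Z ?_ ?_ γ
  · ext τ
    rw [SL_slash_apply, UpperHalfPlane.modular_S_smul, ModularGroup.denom_S]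
    have h := Phi12_X_neg_one_div τ.im_pos
    have hτ := τ.ne_zero
    rw [show -1 / (τ : ℂ) = (-τ : ℂ)⁻¹ by rw [neg_div, one_div, inv_neg]] at h
    rw [UpperHalfPlane.coe_mk, h, zpow_neg]
    norm_cast
    field_simp
  · ext τ
    rw [SL_slash_apply, UpperHalfPlane.modular_T_smul, ModularGroup.denom_apply]
    simp [ModularGroup.T, add_comm (1 : ℂ), Phi12_X_add_one]

/-- `z ↦ Φ12(x1(z),…,x6(z))` transforms as a modular form of weight 12 for the
full modular group `SL(2,ℤ)`. -/
theorem stmt_9 (γ : Matrix.SpecialLinearGroup (Fin 2) ℤ) (z : ℂ) (hz : 0 < z.im) :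
    Phi12 (X (((γ.1 0 0 : ℂ) * z + (γ.1 0 1 : ℂ)) / ((γ.1 1 0 : ℂ) * z + (γ.1 1 1 : ℂ)))) =
      ((γ.1 1 0 : ℂ) * z + (γ.1 1 1 : ℂ)) ^ 12 * Phi12 (X z) := by
  have h := congrFun (slash_Phi12_X γ) (⟨z, hz⟩ : UpperHalfPlane)
  rw [ModularForm.slash_action_eq'_iff, UpperHalfPlane.coe_specialLinearGroup_apply] at h
  simpa only [algebraMap_int_eq, Int.coe_castRingHom, ofReal_intCast, zpow_ofNat] using h

end
end

section
/- For every z in the upper half-plane ℍ: Φ8(x1(z),…,x6(z)) = 0. -/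
open Complex Finset

noncomputable section

local notation "ζ" => zeta13

lemma sum_pow_of_isPrimitiveRoot {x : ℂ} {p : ℕ} (hx : IsPrimitiveRoot x p) (j : ℕ) :
    ∑ ν ∈ range p, (x ^ ν) ^ j = if p ∣ j then (p : ℂ) else 0 := by
  simp_rw [← pow_mul, mul_comm _ j, pow_mul]
  split_ifs with h
  · simp [(hx.pow_eq_one_iff_dvd j).2 h]
  · have h1 : x ^ j ≠ 1 := fun h' => h ((hx.pow_eq_one_iff_dvd j).1 h')
    rw [geom_sum_eq h1, ← pow_mul, mul_comm, pow_mul, hx.pow_eq_one, one_pow, sub_self, zero_div]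

/-- Parseval's identity for the discrete Fourier transform of length 13. -/
lemma sum_sq_eval_of_isPrimitiveRoot {x : ℂ} (hx : IsPrimitiveRoot x 13) (b : ℕ → ℂ) :
    ∑ ν ∈ range 13, (∑ j ∈ range 13, b j * (x ^ ν) ^ j) ^ 2 =
      13 * (b 0 ^ 2 + 2 * (b 1 * b 12 + b 2 * b 11 + b 3 * b 10 + b 4 * b 9 + b 5 * b 8
        + b 6 * b 7)) := by
  have h : ∀ ν, (∑ j ∈ range 13, b j * (x ^ ν) ^ j) ^ 2 =
      ∑ i ∈ range 13, ∑ j ∈ range 13, b i * b j * (x ^ ν) ^ (i + j) := by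
    intro ν
    rw [sq, sum_mul_sum]
    exact sum_congr rfl fun i _ => sum_congr rfl fun j _ => by ring
  simp_rw [h]
  rw [sum_comm]
  have h' : ∀ i ∈ range 13, ∑ ν ∈ range 13, ∑ j ∈ range 13, b i * b j * (x ^ ν) ^ (i + j) =
      ∑ j ∈ range 13, if 13 ∣ i + j then 13 * (b i * b j) else 0 := by
    intro i _
    rw [sum_comm]
    refine sum_congr rfl fun j _ => ?_
    rw [← mul_sum, sum_pow_of_isPrimitiveRoot hx]
    split_ifs <;> push_cast <;> ring
  rw [sum_congr rfl h']
  simp [sum_range_succ]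
  ring

lemma zeta13_isPrimitiveRoot : IsPrimitiveRoot ζ 13 := by
  simpa [zeta13] using Complex.isPrimitiveRoot_exp 13 (by norm_num)

/-- The coefficients of `(A₀ + tA₁ + t⁴A₂ + t⁹A₃ + t³A₄ + t¹²A₅ + t¹⁰A₆)²` modulo `t¹³ - 1`. -/
def squareCoeff (a : ℕ → ℂ) : ℕ → ℂ
  | 0 => a 0 ^ 2 + 2 * a 1 * a 5 + 2 * a 2 * a 3 + 2 * a 4 * a 6
  | 1 => 2 * a 0 * a 1 + 2 * a 2 * a 6
  | 2 => a 1 ^ 2 + 2 * a 4 * a 5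
  | 3 => 2 * a 0 * a 4 + 2 * a 2 * a 5
  | 4 => 2 * a 0 * a 2 + 2 * a 1 * a 4
  | 5 => 2 * a 1 * a 2 + a 3 ^ 2
  | 6 => 2 * a 3 * a 6 + a 4 ^ 2
  | 7 => 2 * a 2 * a 4 + a 6 ^ 2
  | 8 => a 2 ^ 2 + 2 * a 3 * a 5
  | 9 => 2 * a 0 * a 3 + 2 * a 5 * a 6
  | 10 => 2 * a 0 * a 6 + 2 * a 1 * a 3
  | 11 => 2 * a 1 * a 6 + a 5 ^ 2
  | 12 => 2 * a 0 * a 5 + 2 * a 3 * a 4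
  | _ => 0

lemma w_eq_sum_squareCoeff (ν : ℕ) (v : Fin 6 → ℂ) :
    w ν v = ∑ j ∈ range 13, squareCoeff (A · v) j * (ζ ^ ν) ^ j := by
  have ht : (ζ ^ ν) ^ 13 = 1 := by
    rw [← pow_mul, mul_comm, pow_mul, zeta13_isPrimitiveRoot.pow_eq_one, one_pow]
  rw [w]
  simp only [mul_comm _ ν, pow_mul]
  generalize ζ ^ ν = t at ht ⊢
  generalize ha : (A · v) = a
  have hA : ∀ j, A j v = a j := congrFun ha
  simp only [hA, sum_range_succ, sum_range_zero, squareCoeff]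
  linear_combination ((2 * a 1 * a 5 + 2 * a 2 * a 3 + 2 * a 4 * a 6) + t * (2 * a 2 * a 6)
    + t ^ 2 * (2 * a 4 * a 5) + t ^ 3 * (2 * a 2 * a 5) + t ^ 5 * a 3 ^ 2
    + t ^ 6 * (2 * a 3 * a 6) + t ^ 7 * a 6 ^ 2 + t ^ 8 * (2 * a 3 * a 5)
    + t ^ 9 * (2 * a 5 * a 6) + t ^ 11 * a 5 ^ 2) * ht

lemma Phi8_eq (v : Fin 6 → ℂ) :
    Phi8 v = 13 * (squareCoeff (A · v) 0 ^ 2 +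
      2 * (squareCoeff (A · v) 1 * squareCoeff (A · v) 12
        + squareCoeff (A · v) 2 * squareCoeff (A · v) 11
        + squareCoeff (A · v) 3 * squareCoeff (A · v) 10
        + squareCoeff (A · v) 4 * squareCoeff (A · v) 9
        + squareCoeff (A · v) 5 * squareCoeff (A · v) 8
        + squareCoeff (A · v) 6 * squareCoeff (A · v) 7)) + 169 * A 0 v ^ 4 := by
  simp only [Phi8, w_eq_sum_squareCoeff, sum_sq_eval_of_isPrimitiveRoot zeta13_isPrimitiveRoot,
    winf]
  ring

/-- `Φ₈` lies in the ideal generated by the three-term (Plücker) relations. -/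
lemma Phi8_eq_zero_of_three_term {G : ℤ → ℂ} (hneg : ∀ k, G (-k) = -G k)
    (hrefl : ∀ k, G (13 - k) = G k)
    (hG : ∀ a b c d : ℤ, G (a + b) * G (a - b) * (G (c + d) * G (c - d))
      - G (a + c) * G (a - c) * (G (b + d) * G (b - d))
      + G (a + d) * G (a - d) * (G (b + c) * G (b - c)) = 0)
    {v : Fin 6 → ℂ} (h1 : G 1 = v 0) (h2 : G 2 = v 4) (h3 : G 3 = v 1) (h4 : G 4 = v 2)
    (h5 : G 5 = -v 3) (h6 : G 6 = v 5) : Phi8 v = 0 := by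
  have h7 : G 7 = v 5 := by rw [← h6, ← hrefl]; rfl
  have h8 : G 8 = -v 3 := by rw [← h5, ← hrefl]; rfl
  have h9 : G 9 = v 2 := by rw [← h4, ← hrefl]; rfl
  have h10 : G 10 = v 1 := by rw [← h3, ← hrefl]; rfl
  have h11 : G 11 = v 4 := by rw [← h2, ← hrefl]; rfl
  have h0123 : -v 0 ^ 3 * v 3 - v 2 * v 4 ^ 3 + v 0 * v 1 ^ 3 = 0 := by
    have h := hG 0 1 2 3
    norm_num [hneg, h1, h2, h3, h4, h5, h6, h7, h8, h9, h10, h11] at h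
    linear_combination h
  have h0124 : v 0 ^ 2 * v 4 * v 5 + v 1 * v 3 * v 4 ^ 2 + v 0 * v 1 * v 2 ^ 2 = 0 := by
    have h := hG 0 1 2 4
    norm_num [hneg, h1, h2, h3, h4, h5, h6, h7, h8, h9, h10, h11] at h
    linear_combination h
  have h0125 : v 0 ^ 2 * v 1 * v 5 - v 2 * v 4 ^ 2 * v 5 + v 0 * v 1 * v 3 ^ 2 = 0 := by
    have h := hG 0 1 2 5
    norm_num [hneg, h1, h2, h3, h4, h5, h6, h7, h8, h9, h10, h11] at h
    linear_combination h
  have h0126 : -v 0 ^ 2 * v 2 * v 3 + v 3 * v 4 ^ 2 * v 5 + v 0 * v 1 * v 5 ^ 2 = 0 := by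
    have h := hG 0 1 2 6
    norm_num [hneg, h1, h2, h3, h4, h5, h6, h7, h8, h9, h10, h11] at h
    linear_combination h
  have h0134 : v 0 ^ 3 * v 5 + v 1 ^ 3 * v 3 + v 2 ^ 3 * v 4 = 0 := by
    have h := hG 0 1 3 4
    norm_num [hneg, h1, h2, h3, h4, h5, h6, h7, h8, h9, h10, h11] at h
    linear_combination h
  have h0135 : -v 0 ^ 2 * v 3 * v 4 - v 1 ^ 2 * v 2 * v 5 + v 2 * v 3 ^ 2 * v 4 = 0 := by
    have h := hG 0 1 3 5
    norm_num [hneg, h1, h2, h3, h4, h5, h6, h7, h8, h9, h10, h11] at h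
    linear_combination h
  have h0136 : v 0 ^ 2 * v 1 * v 2 + v 1 ^ 2 * v 3 * v 5 + v 2 * v 4 * v 5 ^ 2 = 0 := by
    have h := hG 0 1 3 6
    norm_num [hneg, h1, h2, h3, h4, h5, h6, h7, h8, h9, h10, h11] at h
    linear_combination h
  have h0145 : v 0 ^ 3 * v 2 - v 2 ^ 3 * v 5 - v 1 * v 3 ^ 3 = 0 := by
    have h := hG 0 1 4 5
    norm_num [hneg, h1, h2, h3, h4, h5, h6, h7, h8, h9, h10, h11] at h
    linear_combination h
  have h0146 : v 0 ^ 2 * v 1 * v 4 + v 2 ^ 2 * v 3 * v 5 - v 1 * v 3 * v 5 ^ 2 = 0 := by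
    have h := hG 0 1 4 6
    norm_num [hneg, h1, h2, h3, h4, h5, h6, h7, h8, h9, h10, h11] at h
    linear_combination h
  have h0246 : v 1 * v 4 ^ 3 + v 2 ^ 3 * v 3 + v 4 * v 5 ^ 3 = 0 := by
    have h := hG 0 2 4 6
    norm_num [hneg, h1, h2, h3, h4, h5, h6, h7, h8, h9, h10, h11] at h
    linear_combination h
  have h0256 : v 0 * v 4 ^ 3 + v 2 * v 3 ^ 3 + v 1 * v 5 ^ 3 = 0 := by
    have h := hG 0 2 5 6
    norm_num [hneg, h1, h2, h3, h4, h5, h6, h7, h8, h9, h10, h11] at h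
    linear_combination h
  rw [Phi8_eq]
  simp only [squareCoeff, A]
  linear_combination
    13 * (300 * v 0 ^ 2 * v 3 * v 5 + 48 * v 0 * v 2 ^ 2 * v 4 + 36 * v 0 * v 2 * v 5 ^ 2 - 8 *
      v 0 * v 3 ^ 3 - 8 * v 1 ^ 3 * v 5 - 8 * v 3 * v 4 ^ 3 - 312 * v 1 * v 3 ^ 2 * v 4 - 192 *
      v 0 * v 1 * v 4 * v 5) * h0123 +
    13 * (132 * v 0 ^ 2 * v 1 * v 3 - 48 * v 0 ^ 2 * v 4 ^ 2 - 24 * v 0 * v 1 ^ 2 * v 4 - 120 *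
      v 0 * v 1 * v 2 * v 5 - 24 * v 1 * v 2 * v 3 ^ 2 - 144 * v 2 * v 3 * v 4 ^ 2 + 12 * v 3 *
      v 4 * v 5 ^ 2) * h0124 +
    13 * (-636 * v 0 ^ 2 * v 3 * v 4 - 300 * v 0 * v 1 ^ 2 * v 3 + 48 * v 0 * v 1 * v 4 ^ 2 - 12
      * v 0 * v 2 * v 4 * v 5 + 192 * v 1 ^ 3 * v 4 - 180 * v 1 ^ 2 * v 2 * v 5 - 24 * v 1 * v 2
      ^ 3 + 324 * v 2 * v 3 ^ 2 * v 4 + 180 * v 0 * v 5 ^ 3 + 144 * v 3 ^ 2 * v 5 ^ 2) * h0125 +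
    13 * (-48 * v 0 ^ 2 * v 2 * v 4 + 108 * v 0 * v 1 ^ 2 * v 2 - 24 * v 0 * v 3 ^ 2 * v 5 - 36
      * v 1 * v 3 * v 4 * v 5 + 276 * v 2 ^ 2 * v 3 * v 4 + 144 * v 2 * v 3 * v 5 ^ 2 - 36 * v 0
      ^ 2 * v 5 ^ 2) * h0126 +
    13 * (20 * v 0 ^ 3 * v 5 + 300 * v 0 ^ 2 * v 3 ^ 2 - 144 * v 0 * v 2 * v 3 * v 5 + 16 * v 0
      * v 4 ^ 3 + 20 * v 1 ^ 3 * v 3 - 144 * v 1 * v 2 * v 4 * v 5 - 176 * v 1 * v 5 ^ 3 + 20 *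
      v 2 ^ 3 * v 4 - 32 * v 2 * v 3 ^ 3) * h0134 +
    13 * (156 * v 0 ^ 2 * v 1 * v 5 - 180 * v 0 * v 1 * v 3 ^ 2 + 144 * v 1 * v 2 * v 3 * v 5 -
      168 * v 1 * v 4 ^ 3 + 24 * v 4 * v 5 ^ 3) * h0135 +
    13 * (180 * v 0 * v 4 * v 5 ^ 2 + 144 * v 1 ^ 2 * v 5 ^ 2 + 168 * v 1 * v 2 ^ 2 * v 5 - 48 *
      v 3 ^ 2 * v 4 * v 5) * h0136 +
    13 * (-8 * v 0 ^ 3 * v 4 + 24 * v 0 * v 3 * v 5 ^ 2 - 8 * v 2 * v 5 ^ 3 - 8 * v 3 ^ 3 * v 5)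
      * h0145 +
    13 * (324 * v 0 ^ 2 * v 3 * v 5 + 120 * v 0 * v 3 ^ 3) * h0146 +
    13 * (8 * v 0 * v 5 ^ 3 + 8 * v 1 ^ 3 * v 4 - 8 * v 1 * v 2 ^ 3) * h0246 +
    13 * (20 * v 1 * v 5 ^ 3 + 20 * v 2 * v 3 ^ 3 + 20 * v 0 * v 4 ^ 3) * h0256

lemma qp_add (α β : ℚ) (z : ℂ) : qp (α + β) z = qp α z * qp β z := by
  rw [qp, qp, qp, ← Complex.exp_add]
  push_cast
  ring_nf

lemma summable_qp_quadratic {z : ℂ} (hz : 0 < z.im) {a : ℚ} (ha : 0 < a) (b : ℚ) :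
    Summable fun n : ℤ => qp (a * (n + b) ^ 2) z := by
  have him : 0 < (2 * a * z : ℂ).im := by
    have : (2 * a * z : ℂ).im = 2 * a * z.im := by
      simp [Complex.mul_im]
    rw [this]
    have : (0 : ℝ) < a := by exact_mod_cast ha
    positivity
  refine (((summable_jacobiTheta₂_term_iff (2 * a * b * z) (2 * a * z)).2 him).mul_left
    (qp (a * b ^ 2) z)).congr fun n => ?_
  rw [qp, qp, jacobiTheta₂_term, ← Complex.exp_add]
  push_cast
  ring_nf

/-- The theta series `∑ (-1)ⁿ q^{13 (n + 1/2 - k/13)² / 2}`. -/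
def theta (z : ℂ) (k : ℤ) : ℂ :=
  ∑' n : ℤ, (-1 : ℂ) ^ n * qp (13 / 2 * (n + (1 / 2 - k / 13 : ℚ)) ^ 2) z

/-- The theta series `∑ q^{13 (u - 2k/13)² / 4}` over odd `u`. -/
def thetaOdd (z : ℂ) (k : ℤ) : ℂ := ∑' n : ℤ, qp (13 * (n + (1 / 2 - k / 13 : ℚ)) ^ 2) z

/-- The theta series `∑ q^{13 (u - 2k/13)² / 4}` over even `u`. -/
def thetaEven (z : ℂ) (k : ℤ) : ℂ := ∑' n : ℤ, qp (13 * (n + (-k / 13 : ℚ)) ^ 2) z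

lemma theta_neg (z : ℂ) (k : ℤ) : theta z (-k) = -theta z k := by
  rw [theta, theta, ← tsum_neg, ← (Equiv.subLeft (-1 : ℤ)).tsum_eq]
  refine tsum_congr fun n => ?_
  have h : (-1 : ℂ) ^ (-1 - n) = -(-1) ^ n := by
    rw [zpow_sub₀ (by norm_num), zpow_neg_one, div_eq_mul_inv, ← inv_zpow]
    norm_num
  rw [Equiv.subLeft_apply, h, neg_mul]
  congr 3
  push_cast
  ring

lemma theta_reflect (z : ℂ) (k : ℤ) : theta z (13 - k) = theta z k := by
  rw [theta, theta, ← (Equiv.neg ℤ).tsum_eq]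
  refine tsum_congr fun n => ?_
  have h : (-1 : ℂ) ^ (-n) = (-1) ^ n := by
    rw [zpow_neg, ← inv_zpow]
    norm_num
  rw [Equiv.neg_apply, h]
  congr 2
  push_cast
  ring

/-- Splitting of `ℤ × ℤ` according to the parity of the sum of the coordinates. -/
def paritySplit : (ℤ × ℤ) ⊕ (ℤ × ℤ) ≃ ℤ × ℤ :=
  Equiv.ofBijective
    (Sum.elim (fun p => (p.1 + p.2, p.1 - p.2)) (fun p => (p.1 + p.2, p.1 - p.2 - 1))) <| by
    constructor
    · rintro (⟨a, b⟩ | ⟨a, b⟩) (⟨c, d⟩ | ⟨c, d⟩) h <;>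
        simp only [Sum.elim_inl, Sum.elim_inr, Prod.mk.injEq] at h
      · obtain rfl : a = c := by omega
        obtain rfl : b = d := by omega
        rfl
      · omega
      · omega
      · obtain rfl : a = c := by omega
        obtain rfl : b = d := by omega
        rfl
    · rintro ⟨m, n⟩
      rcases Int.even_or_odd' (m + n) with ⟨k, hk | hk⟩
      · exact ⟨Sum.inl (k, m - k), Prod.ext (by simp) (by simp; omega)⟩
      · exact ⟨Sum.inr (k + 1, m - k - 1), Prod.ext (by simp) (by simp; omega)⟩

lemma paritySplit_inl (p : ℤ × ℤ) : paritySplit (Sum.inl p) = (p.1 + p.2, p.1 - p.2) := rfl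

lemma paritySplit_inr (p : ℤ × ℤ) : paritySplit (Sum.inr p) = (p.1 + p.2, p.1 - p.2 - 1) := rfl

lemma neg_one_zpow_mul_zpow (m n : ℤ) : (-1 : ℂ) ^ m * (-1) ^ n = (-1) ^ (m + n) :=
  (zpow_add₀ (by norm_num) m n).symm

lemma theta_add_mul_theta_sub {z : ℂ} (hz : 0 < z.im) (x y : ℤ) :
    theta z (x + y) * theta z (x - y) =
      thetaOdd z x * thetaEven z y - thetaEven z x * thetaOdd z y := by
  have hs : ∀ b : ℚ, Summable fun n : ℤ => ‖(-1 : ℂ) ^ n * qp (13 / 2 * (n + b) ^ 2) z‖ := by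
    intro b
    simpa using (summable_qp_quadratic hz (by norm_num) b).norm
  have hs' : ∀ b : ℚ, Summable fun n : ℤ => ‖qp (13 * (n + b) ^ 2) z‖ := fun b =>
    (summable_qp_quadratic hz (by norm_num) b).norm
  have hprod : ∀ b c : ℚ, HasSum
      (fun p : ℤ × ℤ => qp (13 * (p.1 + b) ^ 2) z * qp (13 * (p.2 + c) ^ 2) z)
      ((∑' n : ℤ, qp (13 * (n + b) ^ 2) z) * ∑' n : ℤ, qp (13 * (n + c) ^ 2) z) := by
    intro b c
    rw [tsum_mul_tsum_of_summable_norm (hs' b) (hs' c)]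
    exact (summable_mul_of_summable_norm (hs' b) (hs' c)).hasSum
  rw [theta, theta, tsum_mul_tsum_of_summable_norm (hs _) (hs _), ← paritySplit.tsum_eq]
  refine HasSum.tsum_eq ?_
  rw [sub_eq_add_neg (thetaOdd z x * thetaEven z y)]
  apply HasSum.sum
  · refine (congrArg (HasSum · _) ?_).mpr (hprod (1 / 2 - x / 13) (-y / 13))
    funext ⟨k, l⟩
    have h : (-1 : ℂ) ^ (k + l) * (-1) ^ (k - l) = 1 := by
      rw [neg_one_zpow_mul_zpow, show k + l + (k - l) = 2 * k by ring, zpow_mul]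
      norm_num
    simp only [Function.comp_apply, paritySplit_inl]
    rw [mul_mul_mul_comm, h, one_mul, ← qp_add, ← qp_add]
    congr 1
    push_cast
    ring
  · refine (congrArg (HasSum · _) ?_).mpr (hprod (-x / 13) (1 / 2 - y / 13)).neg
    funext ⟨k, l⟩
    have h : (-1 : ℂ) ^ (k + l) * (-1) ^ (k - l - 1) = -1 := by
      rw [neg_one_zpow_mul_zpow, show k + l + (k - l - 1) = 2 * (k - 1) + 1 by ring,
        zpow_add₀ (by norm_num), zpow_mul]
      norm_num
    simp only [Function.comp_apply, paritySplit_inr]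
    rw [mul_mul_mul_comm, h, neg_one_mul, ← qp_add, ← qp_add]
    congr 2
    push_cast
    ring

lemma theta_eq (z : ℂ) (k : ℤ) :
    theta z k = qp ((13 - 2 * k) ^ 2 / 104) z * thetaSum (13 - 2 * k) z := by
  rw [theta, thetaSum, ← tsum_mul_left]
  refine tsum_congr fun n => ?_
  rw [mul_left_comm, ← qp_add]
  congr 2
  push_cast
  ring

/-- `Φ8(x1(z),…,x6(z)) = 0` on ℍ. -/
theorem stmt_11 (z : ℂ) (hz : 0 < z.im) : Phi8 (X z) = 0 := by
  refine Phi8_eq_zero_of_three_term (G := fun k => etaF z * theta z k) ?_ ?_ ?_ ?_ ?_ ?_ ?_ ?_ ?_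
  · intro k
    simp only [theta_neg, mul_neg]
  · intro k
    simp only [theta_reflect]
  · intro a b c d
    have h : ∀ x y, etaF z * theta z (x + y) * (etaF z * theta z (x - y)) = etaF z ^ 2 *
        (thetaOdd z x * thetaEven z y - thetaEven z x * thetaOdd z y) := by
      intro x y
      rw [← theta_add_mul_theta_sub hz]
      ring
    simp only [h]
    ring
  all_goals
    simp only [X, theta_eq]
    norm_num [thc]

end
end
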